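/- arXiv:1702.07201 — 2 statements merged into one kernel-verified Lean document; each statement's English description precedes it below -/
import Mathlib

section
/- (Almost orthogonality on ℍ^n.) Suppose φ and ϕ are C¹ functions on ℍ^n satisfying, for some C₀ > 0 and all g ∈ ℍ^n: ∫_{ℍ^n} φ(g) dg = 0 and ∫_{ℍ^n} ϕ(g) dg = 0; |φ(g)|, |ϕ(g)| ≤ C₀ (1 + ρ(g))^{−(2n+3)}; |∇_z φ(g)|, |∇_z ϕ(g)| ≤ C₀ (1 + ρ(g))^{−(2n+4)}; and |∂φ/∂t(g)|, |∂ϕ/∂t(g)| ≤ C₀ (1 + ρ(g))^{−(2n+5)}. Then for every ε ∈ (0,1) there is a constant C > 0 such that for all j, j' ∈ ℤ and all g ∈ ℍ^n, |φ_j ∗ ϕ_{j'}(g)| ≤ C · 2^{−|j−j'|ε} · 2^{−(j∧j')} / (2^{−(j∧j')} + ρ(g))^{2n+3}, where j∧j' = min(j,j'). -/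
open MeasureTheory

/-- The underlying space of the Heisenberg group `ℍⁿ ≅ ℝⁿ × ℝⁿ × ℝ`. -/
abbrev Heis (n : ℕ) := (Fin n → ℝ) × (Fin n → ℝ) × ℝ

/-- The Heisenberg group law. -/
def hmul {n : ℕ} (g g' : Heis n) : Heis n :=
  (g.1 + g'.1, g.2.1 + g'.2.1,
    g.2.2 + g'.2.2 + 2 * (∑ i, g.2.1 i * g'.1 i) - 2 * (∑ i, g.1 i * g'.2.1 i))

/-- The Heisenberg group inverse. -/
def hinv {n : ℕ} (g : Heis n) : Heis n := (-g.1, -g.2.1, -g.2.2)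

/-- The Euclidean norm of the horizontal component `z = (x, y) ∈ ℝ^{2n}`. -/
noncomputable def znorm {n : ℕ} (g : Heis n) : ℝ :=
  Real.sqrt (∑ i, g.1 i ^ 2 + ∑ i, g.2.1 i ^ 2)

/-- The homogeneous norm `ρ([z,t]) = max {|z|, |t|^{1/2}}`. -/
noncomputable def hnorm {n : ℕ} (g : Heis n) : ℝ :=
  max (znorm g) (Real.sqrt |g.2.2|)

/-- The anisotropic dilations `δ_r([z,t]) = [rz, r²t]`. -/
def hdil {n : ℕ} (r : ℝ) (g : Heis n) : Heis n := (r • g.1, r • g.2.1, r ^ 2 * g.2.2)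

/-- Heisenberg convolution `(f ∗ h)(g) = ∫ f(w) h(w⁻¹ ∘ g) dw`. -/
noncomputable def hconv {n : ℕ} (f h : Heis n → ℝ) (g : Heis n) : ℝ :=
  ∫ w, f w * h (hmul (hinv w) g)

/-- The normalized dilation `D_r f(g) = r^{2n+2} f(δ_r g)`. -/
noncomputable def hdilNorm {n : ℕ} (r : ℝ) (f : Heis n → ℝ) (g : Heis n) : ℝ :=
  r ^ (2 * n + 2) * f (hdil r g)

/-- The Euclidean length of the horizontal gradient `∇_z f` (gradient in the `2n`
variables `(x, y)`). -/
noncomputable def zgrad {n : ℕ} (f : Heis n → ℝ) (g : Heis n) : ℝ :=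
  Real.sqrt (∑ i, fderiv ℝ f g (Pi.single i 1, 0, 0) ^ 2 +
      ∑ i, fderiv ℝ f g (0, Pi.single i 1, 0) ^ 2)

/-- The derivative `∂f/∂t` in the central variable. -/
noncomputable def tderiv {n : ℕ} (f : Heis n → ℝ) (g : Heis n) : ℝ :=
  fderiv ℝ f g (0, 0, 1)

section Norm

variable {n : ℕ}

/-- Cauchy–Schwarz for pairs of vectors. -/
lemma abs_pairing_le (a b c d : Fin n → ℝ) :
    |∑ i, a i * c i + ∑ i, b i * d i| ≤
      Real.sqrt (∑ i, a i ^ 2 + ∑ i, b i ^ 2) * Real.sqrt (∑ i, c i ^ 2 + ∑ i, d i ^ 2) := by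
  have h := Finset.sum_mul_sq_le_sq_mul_sq (Finset.univ : Finset (Fin n ⊕ Fin n))
    (Sum.elim a b) (Sum.elim c d)
  simp only [Fintype.sum_sum_type, Sum.elim_inl, Sum.elim_inr] at h
  rw [← Real.sqrt_mul (by positivity)]
  exact Real.abs_le_sqrt h

lemma znorm_nonneg (g : Heis n) : 0 ≤ znorm g := Real.sqrt_nonneg _

lemma znorm_sq (g : Heis n) : znorm g ^ 2 = ∑ i, g.1 i ^ 2 + ∑ i, g.2.1 i ^ 2 :=
  Real.sq_sqrt (by positivity)

lemma hnorm_nonneg (g : Heis n) : 0 ≤ hnorm g := le_max_of_le_left (znorm_nonneg g)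

lemma znorm_le_hnorm (g : Heis n) : znorm g ≤ hnorm g := le_max_left _ _

lemma abs_central_le (g : Heis n) : |g.2.2| ≤ hnorm g ^ 2 :=
  (Real.sqrt_le_left (hnorm_nonneg g)).1 (le_max_right _ _)

lemma hnorm_le_of {g : Heis n} {a : ℝ} (ha : 0 ≤ a) (hz : znorm g ≤ a) (ht : |g.2.2| ≤ a ^ 2) :
    hnorm g ≤ a :=
  max_le hz ((Real.sqrt_le_left ha).2 ht)

lemma hinv_eq_neg (g : Heis n) : hinv g = -g := rfl

lemma znorm_neg (g : Heis n) : znorm (-g) = znorm g := by simp [znorm]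

lemma hnorm_neg (g : Heis n) : hnorm (-g) = hnorm g := by simp [hnorm, znorm_neg]

lemma znorm_smul (s : ℝ) (hs : 0 ≤ s) (g : Heis n) : znorm (s • g) = s * znorm g := by
  simp only [znorm, Prod.smul_fst, Prod.smul_snd, Pi.smul_apply, smul_eq_mul, mul_pow,
    ← Finset.mul_sum, ← mul_add]
  rw [Real.sqrt_mul (by positivity), Real.sqrt_sq hs]

lemma hnorm_hdil (r : ℝ) (hr : 0 ≤ r) (g : Heis n) : hnorm (hdil r g) = r * hnorm g := by
  have h1 : znorm (hdil r g) = r * znorm g := by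
    rw [← znorm_smul r hr]; rfl
  rw [hnorm, hnorm, h1, mul_max_of_nonneg _ _ hr]
  congr 1
  simp only [hdil]
  rw [abs_mul, abs_of_nonneg (by positivity : 0 ≤ r ^ 2), Real.sqrt_mul (by positivity),
    Real.sqrt_sq hr]

lemma abs_symplectic_le (g g' : Heis n) :
    |∑ i, g.2.1 i * g'.1 i - ∑ i, g.1 i * g'.2.1 i| ≤ znorm g * znorm g' := by
  have h := abs_pairing_le g.2.1 (-g.1) g'.1 g'.2.1
  simp only [Pi.neg_apply, neg_mul, Finset.sum_neg_distrib, neg_sq, ← sub_eq_add_neg] at h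
  rwa [add_comm (∑ i, g.2.1 i ^ 2)] at h

lemma znorm_add_le (g g' : Heis n) : znorm (g + g') ≤ znorm g + znorm g' := by
  refine (Real.sqrt_le_left (add_nonneg (znorm_nonneg _) (znorm_nonneg _))).2 ?_
  have h := (le_abs_self _).trans (abs_pairing_le g.1 g.2.1 g'.1 g'.2.1)
  change _ ≤ znorm g * znorm g' at h
  have h1 := znorm_sq g
  have h2 := znorm_sq g'
  have h3 : ∑ i, (g + g').1 i ^ 2 + ∑ i, (g + g').2.1 i ^ 2 =
      znorm g ^ 2 + znorm g' ^ 2 + 2 * (∑ i, g.1 i * g'.1 i + ∑ i, g.2.1 i * g'.2.1 i) := by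
    simp only [h1, h2, Prod.fst_add, Prod.snd_add, Pi.add_apply, add_sq, Finset.sum_add_distrib,
      mul_assoc, ← Finset.mul_sum]
    ring
  rw [h3]
  nlinarith

/-- The homogeneous norm is subadditive. -/
lemma hnorm_hmul_le (g g' : Heis n) : hnorm (hmul g g') ≤ hnorm g + hnorm g' := by
  have hg := hnorm_nonneg g
  have hg' := hnorm_nonneg g'
  refine hnorm_le_of (by positivity) ?_ ?_
  · have h : znorm (hmul g g') = znorm (g + g') := rfl
    rw [h]
    exact (znorm_add_le g g').trans (add_le_add (znorm_le_hnorm g) (znorm_le_hnorm g'))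
  · have h1 := abs_central_le g
    have h2 := abs_central_le g'
    have h3 := (abs_symplectic_le g g').trans
      (mul_le_mul (znorm_le_hnorm g) (znorm_le_hnorm g') (znorm_nonneg _) hg)
    have h4 : (hmul g g').2.2 = g.2.2 + g'.2.2 +
        2 * (∑ i, g.2.1 i * g'.1 i - ∑ i, g.1 i * g'.2.1 i) := by
      simp only [hmul]; ring
    rw [h4]
    rw [abs_le] at *
    constructor <;> nlinarith

lemma hmul_hinv_cancel_left (w g : Heis n) : hmul w (hmul (hinv w) g) = g := by
  ext
  · simp [hmul, hinv]
  · simp [hmul, hinv]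
  · simp only [hmul, hinv, Pi.add_apply, Pi.neg_apply, mul_add, Finset.sum_add_distrib, neg_mul,
      mul_neg, Finset.sum_neg_distrib]
    simp only [mul_comm]
    ring

lemma hnorm_le_add (w g : Heis n) : hnorm g ≤ hnorm w + hnorm (hmul (hinv w) g) := by
  simpa only [hmul_hinv_cancel_left] using hnorm_hmul_le w (hmul (hinv w) g)

lemma hnorm_smul_le {s : ℝ} (hs : 0 ≤ s) (hs1 : s ≤ 1) (g : Heis n) :
    hnorm (s • g) ≤ hnorm g := by
  refine hnorm_le_of (hnorm_nonneg g) ?_ ?_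
  · rw [znorm_smul s hs]
    exact (mul_le_of_le_one_left (znorm_nonneg g) hs1).trans (znorm_le_hnorm g)
  · simp only [Prod.smul_snd, smul_eq_mul, abs_mul, abs_of_nonneg hs]
    exact (mul_le_of_le_one_left (abs_nonneg _) hs1).trans (abs_central_le g)

/-- Left translates of `g` by the Euclidean segment from `0` to `w⁻¹` form a Euclidean segment. -/
lemma hmul_hinv_smul (s : ℝ) (w g : Heis n) :
    hmul (hinv (s • w)) g = g + s • (hmul (hinv w) g - g) := by
  ext
  · simp [hmul, hinv]; ring
  · simp [hmul, hinv]; ring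
  · simp only [hmul, hinv, Prod.smul_fst, Prod.smul_snd, Prod.snd_add, Prod.snd_sub, Pi.smul_apply,
      Pi.neg_apply, smul_eq_mul, neg_mul, Finset.sum_neg_distrib, mul_assoc, ← Finset.mul_sum]
    ring

lemma znorm_translate_sub (w g : Heis n) : znorm (hmul (hinv w) g - g) = znorm w := by
  rw [← znorm_neg w]
  simp [znorm, hmul, hinv]

lemma abs_central_translate_sub_le (w g : Heis n) :
    |(hmul (hinv w) g - g).2.2| ≤ hnorm w ^ 2 + 2 * (hnorm w * hnorm g) := by
  have h1 := abs_central_le w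
  have h3 := (abs_symplectic_le w g).trans
    (mul_le_mul (znorm_le_hnorm w) (znorm_le_hnorm g) (znorm_nonneg _) (hnorm_nonneg w))
  have h4 : (hmul (hinv w) g - g).2.2 =
      -w.2.2 - 2 * (∑ i, w.2.1 i * g.1 i - ∑ i, w.1 i * g.2.1 i) := by
    simp only [hmul, hinv, Prod.snd_sub, Pi.neg_apply, neg_mul, Finset.sum_neg_distrib]; ring
  rw [h4]
  rw [abs_le] at *
  constructor <;> linarith

lemma hmul_hinv_zero (w : Heis n) : hmul (hinv w) 0 = -w := by
  ext <;> simp [hmul, hinv]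

lemma hinv_hmul (w g : Heis n) : -hmul (hinv w) g = hmul (-g) w := by
  ext
  · simp [hmul, hinv]
  · simp [hmul, hinv]
  · simp [hmul, hinv, mul_comm]; ring

lemma hdil_hmul_hinv (s : ℝ) (w g : Heis n) :
    hdil s (hmul (hinv w) g) = hmul (hinv (hdil s w)) (hdil s g) := by
  ext
  · simp [hmul, hinv, hdil]
  · simp [hmul, hinv, hdil]
  · simp only [hmul, hinv, hdil, Pi.smul_apply, Pi.neg_apply, smul_eq_mul]
    have h : ∀ a b : Fin n → ℝ, ∑ i, -(s * a i) * (s * b i) = s ^ 2 * ∑ i, -a i * b i := by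
      intro a b
      rw [Finset.mul_sum]
      exact Finset.sum_congr rfl fun i _ => by ring
    rw [h, h]
    ring

lemma hdil_hdil (r s : ℝ) (g : Heis n) : hdil r (hdil s g) = hdil (r * s) g := by
  simp [hdil, smul_smul]; ring

lemma hdil_neg (r : ℝ) (g : Heis n) : hdil r (-g) = -hdil r g := by simp [hdil]

lemma continuous_znorm : Continuous (znorm : Heis n → ℝ) := by
  unfold znorm; fun_prop

lemma continuous_hnorm : Continuous (hnorm : Heis n → ℝ) := by
  unfold hnorm
  exact continuous_znorm.max (by fun_prop)

lemma continuous_hdil (r : ℝ) : Continuous (hdil r : Heis n → Heis n) := by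
  unfold hdil; fun_prop

lemma continuous_hmul_hinv (g : Heis n) : Continuous fun w : Heis n => hmul (hinv w) g := by
  unfold hmul hinv; fun_prop

end Norm

section Measure

variable {n : ℕ}

lemma measurePreserving_hmul_hinv (g : Heis n) :
    MeasurePreserving (fun w : Heis n => hmul (hinv w) g) := by
  have hfib : ∀ x y : Fin n → ℝ, MeasurePreserving (fun t : ℝ =>
      (2 * (∑ i, -y i * g.1 i) - 2 * (∑ i, -x i * g.2.1 i) + g.2.2) - t) :=
    fun x y => Measure.measurePreserving_sub_left volume _
  have hsnd : ∀ x : Fin n → ℝ, MeasurePreserving (fun p : (Fin n → ℝ) × ℝ => (g.2.1 - p.1,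
      (2 * (∑ i, -p.1 i * g.1 i) - 2 * (∑ i, -x i * g.2.1 i) + g.2.2) - p.2)) := fun x =>
    (Measure.measurePreserving_sub_left volume g.2.1).skew_product
      (g := fun y t => (2 * (∑ i, -y i * g.1 i) - 2 * (∑ i, -x i * g.2.1 i) + g.2.2) - t)
      (Continuous.measurable (by unfold Function.uncurry; fun_prop))
      (Filter.Eventually.of_forall fun y => (hfib x y).map_eq)
  have h := (Measure.measurePreserving_sub_left volume g.1).skew_product
      (g := fun x (p : (Fin n → ℝ) × ℝ) => (g.2.1 - p.1,
        (2 * (∑ i, -p.1 i * g.1 i) - 2 * (∑ i, -x i * g.2.1 i) + g.2.2) - p.2))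
      (Continuous.measurable (by unfold Function.uncurry; fun_prop))
      (Filter.Eventually.of_forall fun x => (hsnd x).map_eq)
  have heq : (fun w : Heis n => hmul (hinv w) g) = fun p => (g.1 - p.1, g.2.1 - p.2.1,
      (2 * (∑ i, -p.2.1 i * g.1 i) - 2 * (∑ i, -p.1 i * g.2.1 i) + g.2.2) - p.2.2) := by
    ext w
    · simp [hmul, hinv]; ring
    · simp [hmul, hinv]; ring
    · simp [hmul, hinv]; ring
  rw [heq]
  exact h

instance isAddHaarMeasure_volume_heis : (volume : Measure (Heis n)).IsAddHaarMeasure :=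
  haveI : (volume : Measure ((Fin n → ℝ) × ℝ)).IsAddHaarMeasure :=
    Measure.prod.instIsAddHaarMeasure volume volume
  Measure.prod.instIsAddHaarMeasure volume volume

lemma map_hdil_volume {r : ℝ} (hr : 0 < r) :
    Measure.map (hdil r : Heis n → Heis n) volume =
      ENNReal.ofReal (r ^ (2 * n + 2))⁻¹ • volume := by
  set L : Heis n →ₗ[ℝ] Heis n := LinearMap.prodMap (r • LinearMap.id)
    (LinearMap.prodMap (r • LinearMap.id) (r ^ 2 • LinearMap.id)) with hL
  have hdet : LinearMap.det L = r ^ (2 * n + 2) := by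
    rw [hL, LinearMap.det_prodMap, LinearMap.det_prodMap]
    simp only [LinearMap.det_smul, LinearMap.det_id, Module.finrank_fin_fun, Module.finrank_self]
    ring
  have hLr : (hdil r : Heis n → Heis n) = L := by
    ext g <;> simp [hL, hdil]
  have hpos : 0 < r ^ (2 * n + 2) := by positivity
  rw [hLr, Measure.map_linearMap_addHaar_eq_smul_addHaar volume (by rw [hdet]; exact hpos.ne'),
    hdet, abs_of_pos (by positivity)]

lemma integrable_comp_hdil {F : Heis n → ℝ} (hF : Integrable F) {r : ℝ} (hr : 0 < r) :
    Integrable fun w => F (hdil r w) := by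
  refine Integrable.comp_measurable ?_ (continuous_hdil r).measurable
  rw [map_hdil_volume hr]
  exact hF.smul_measure ENNReal.ofReal_ne_top

lemma integral_comp_hdil {F : Heis n → ℝ} (hF : Continuous F) {r : ℝ} (hr : 0 < r) :
    ∫ w, F (hdil r w) = (r ^ (2 * n + 2))⁻¹ * ∫ w, F w := by
  rw [← integral_map (continuous_hdil r).aemeasurable hF.aestronglyMeasurable, map_hdil_volume hr,
    integral_smul_measure, ENNReal.toReal_ofReal (by positivity), smul_eq_mul]

lemma integral_comp_hmul_hinv {F : Heis n → ℝ} (hF : Continuous F) (g : Heis n) :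
    ∫ w, F (hmul (hinv w) g) = ∫ w, F w := by
  have h := measurePreserving_hmul_hinv g
  rw [← integral_map h.measurable.aemeasurable hF.aestronglyMeasurable, h.map_eq]

lemma integrable_comp_hmul_hinv {F : Heis n → ℝ} (hF : Integrable F) (g : Heis n) :
    Integrable fun w => F (hmul (hinv w) g) :=
  (measurePreserving_hmul_hinv g).integrable_comp_of_integrable hF

lemma continuous_one_add_hnorm_rpow (s : ℝ) :
    Continuous fun g : Heis n => (1 + hnorm g) ^ s :=
  (continuous_const.add continuous_hnorm).rpow_const fun g =>
    Or.inl (add_pos_of_pos_of_nonneg one_pos (hnorm_nonneg g)).ne'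

lemma norm_fst_le_znorm (g : Heis n) : ‖g.1‖ ≤ znorm g := by
  refine (pi_norm_le_iff_of_nonneg (znorm_nonneg g)).2 fun i => Real.abs_le_sqrt ?_
  have h := Finset.single_le_sum (f := fun i => g.1 i ^ 2) (fun i _ => sq_nonneg _)
    (Finset.mem_univ i)
  have h2 : 0 ≤ ∑ i, g.2.1 i ^ 2 := by positivity
  linarith

lemma norm_snd_le_znorm (g : Heis n) : ‖g.2.1‖ ≤ znorm g := by
  refine (pi_norm_le_iff_of_nonneg (znorm_nonneg g)).2 fun i => Real.abs_le_sqrt ?_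
  have h := Finset.single_le_sum (f := fun i => g.2.1 i ^ 2) (fun i _ => sq_nonneg _)
    (Finset.mem_univ i)
  have h2 : 0 ≤ ∑ i, g.1 i ^ 2 := by positivity
  linarith

/-- Powers of `1 + ρ` below the negative of the homogeneous dimension are integrable. -/
lemma integrable_one_add_hnorm_rpow {s : ℝ} (hs : 2 * (n : ℝ) + 2 < s) :
    Integrable fun g : Heis n => (1 + hnorm g) ^ (-s) := by
  obtain ⟨d, hd, rfl⟩ : ∃ d : ℝ, 0 < d ∧ s = (n + d) + ((n + d) + 2 * (1 + d)) :=
    ⟨(s - (2 * n + 2)) / 4, by linarith, by ring⟩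
  have hE : Integrable fun x : Fin n → ℝ => (1 + ‖x‖) ^ (-(n + d)) :=
    integrable_one_add_norm (by simpa using hd)
  have hR : Integrable fun t : ℝ => (1 + ‖t‖) ^ (-(1 + d)) :=
    integrable_one_add_norm (by simpa using hd)
  have hprod : Integrable fun g : Heis n =>
      (1 + ‖g.1‖) ^ (-(n + d)) * ((1 + ‖g.2.1‖) ^ (-(n + d)) * (1 + ‖g.2.2‖) ^ (-(1 + d))) :=
    hE.mul_prod (hE.mul_prod hR)
  refine hprod.mono' (continuous_one_add_hnorm_rpow _).aestronglyMeasurable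
    (Filter.Eventually.of_forall fun g => ?_)
  have hρ := hnorm_nonneg g
  have hρ1 : 0 < 1 + hnorm g := by positivity
  have hx := (norm_fst_le_znorm g).trans (znorm_le_hnorm g)
  have hy := (norm_snd_le_znorm g).trans (znorm_le_hnorm g)
  have ht : 1 + ‖g.2.2‖ ≤ (1 + hnorm g) ^ (2 : ℝ) := by
    have := abs_central_le g
    rw [Real.rpow_two, Real.norm_eq_abs]
    nlinarith
  have hn : (0 : ℝ) ≤ n := n.cast_nonneg
  rw [Real.norm_of_nonneg (Real.rpow_nonneg hρ1.le _), neg_add (_ + _), neg_add _ (2 * _),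
    Real.rpow_add hρ1, Real.rpow_add hρ1, ← mul_neg, Real.rpow_mul hρ1.le]
  gcongr ?_ * (?_ * ?_)
  · exact Real.rpow_le_rpow_of_nonpos (by positivity) (by linarith) (by linarith)
  · exact Real.rpow_le_rpow_of_nonpos (by positivity) (by linarith) (by linarith)
  · exact Real.rpow_le_rpow_of_nonpos (by positivity) ht (by linarith)

end Measure

section Smooth

variable {n : ℕ}

lemma continuousLinearMap_apply_eq_sum (L : Heis n →L[ℝ] ℝ) (v : Heis n) :
    L v = ∑ i, L (Pi.single i 1, 0, 0) * v.1 i + ∑ i, L (0, Pi.single i 1, 0) * v.2.1 i +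
      L (0, 0, 1) * v.2.2 := by
  have h1 : v = ∑ i, v.1 i • ((Pi.single i 1, 0, 0) : Heis n) +
      ∑ i, v.2.1 i • ((0, Pi.single i 1, 0) : Heis n) + v.2.2 • ((0, 0, 1) : Heis n) := by
    ext j <;> simp [Prod.fst_sum, Prod.snd_sum, Finset.sum_apply, Pi.single_apply]
  conv_lhs => rw [h1]
  simp only [map_add, map_sum, map_smul, smul_eq_mul, mul_comm]

lemma abs_fderiv_apply_le (f : Heis n → ℝ) (g v : Heis n) :
    |fderiv ℝ f g v| ≤ zgrad f g * znorm v + |tderiv f g| * |v.2.2| := by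
  rw [continuousLinearMap_apply_eq_sum]
  refine (abs_add_le _ _).trans (add_le_add (abs_pairing_le _ _ _ _) ?_)
  rw [abs_mul]
  rfl

lemma fderiv_comp_neg_apply (f : Heis n → ℝ) (g v : Heis n) :
    fderiv ℝ (fun g => f (-g)) g v = -fderiv ℝ f (-g) v := by
  have h := (ContinuousLinearEquiv.neg ℝ (M := Heis n)).comp_right_fderiv (f := f) (x := g)
  have h' := congrArg (fun L : Heis n →L[ℝ] ℝ => L v) h
  simpa [Function.comp_def] using h'

/-- The hypotheses on the functions in the almost orthogonality estimate. -/
structure IsHeisMolecule (C : ℝ) (f : Heis n → ℝ) : Prop where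
  contDiff : ContDiff ℝ 1 f
  integral_eq_zero : ∫ g, f g = 0
  abs_le : ∀ g, |f g| ≤ C / (1 + hnorm g) ^ (2 * n + 3)
  zgrad_le : ∀ g, zgrad f g ≤ C / (1 + hnorm g) ^ (2 * n + 4)
  abs_tderiv_le : ∀ g, |tderiv f g| ≤ C / (1 + hnorm g) ^ (2 * n + 5)

namespace IsHeisMolecule

variable {C : ℝ} {f : Heis n → ℝ}

lemma comp_neg (hf : IsHeisMolecule C f) : IsHeisMolecule C fun g => f (-g) where
  contDiff := hf.contDiff.comp contDiff_neg
  integral_eq_zero := by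
    have h := integral_comp_hmul_hinv hf.contDiff.continuous 0
    simpa only [hmul_hinv_zero, hf.integral_eq_zero] using h
  abs_le g := by simpa only [hnorm_neg] using hf.abs_le (-g)
  zgrad_le g := by
    have h : zgrad (fun g => f (-g)) g = zgrad f (-g) := by simp [zgrad, fderiv_comp_neg_apply]
    simpa only [h, hnorm_neg] using hf.zgrad_le (-g)
  abs_tderiv_le g := by
    have h : |tderiv (fun g => f (-g)) g| = |tderiv f (-g)| := by
      simp [tderiv, fderiv_comp_neg_apply]
    simpa only [h, hnorm_neg] using hf.abs_tderiv_le (-g)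

lemma continuous (hf : IsHeisMolecule C f) : Continuous f := hf.contDiff.continuous

lemma abs_translate_sub_le (hf : IsHeisMolecule C f) (hC : 0 < C) {w g : Heis n}
    (hw : hnorm w ≤ (1 + hnorm g) / 2) :
    |f (hmul (hinv w) g) - f g| ≤
      C * 2 ^ (2 * n + 7) * (hnorm w / (1 + hnorm g)) / (1 + hnorm g) ^ (2 * n + 3) := by
  set v : Heis n := hmul (hinv w) g - g with hv
  set A := 1 + hnorm g with hA
  have hg0 := hnorm_nonneg g
  have hw0 := hnorm_nonneg w
  have hApos : 0 < A := by positivity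
  have hderiv : ∀ s : ℝ, HasDerivAt (fun s : ℝ => f (g + s • v)) (fderiv ℝ f (g + s • v) v) s := by
    intro s
    have h1 : HasDerivAt (fun s : ℝ => g + s • v) v s := by
      simpa using ((hasDerivAt_id s).smul_const v).const_add g
    exact ((hf.contDiff.differentiable one_ne_zero) _).hasFDerivAt.comp_hasDerivAt s h1
  have hbound : ∀ s ∈ Set.Ico (0 : ℝ) 1, ‖fderiv ℝ f (g + s • v) v‖ ≤
      C * 2 ^ (2 * n + 7) * (hnorm w / A) / A ^ (2 * n + 3) := by
    intro s hs
    set p := g + s • v with hp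
    have hpA : A / 2 ≤ 1 + hnorm p := by
      have h1 := hnorm_le_add (s • w) g
      rw [hmul_hinv_smul] at h1
      have h2 := hnorm_smul_le hs.1 hs.2.le w
      change hnorm g ≤ hnorm (s • w) + hnorm p at h1
      linarith
    have hz : zgrad f p ≤ C / (A / 2) ^ (2 * n + 4) :=
      (hf.zgrad_le p).trans (by gcongr)
    have ht : |tderiv f p| ≤ C / (A / 2) ^ (2 * n + 5) :=
      (hf.abs_tderiv_le p).trans (by gcongr)
    have hvz : znorm v ≤ hnorm w := (znorm_translate_sub w g).trans_le (znorm_le_hnorm w)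
    have hvt : |v.2.2| ≤ 5 / 2 * (hnorm w * A) := by
      refine (abs_central_translate_sub_le w g).trans ?_
      nlinarith [mul_le_mul_of_nonneg_left hw hw0]
    calc ‖fderiv ℝ f p v‖ ≤ zgrad f p * znorm v + |tderiv f p| * |v.2.2| :=
          abs_fderiv_apply_le f p v
      _ ≤ C / (A / 2) ^ (2 * n + 4) * hnorm w +
            C / (A / 2) ^ (2 * n + 5) * (5 / 2 * (hnorm w * A)) := by
          gcongr
          exact znorm_nonneg v
      _ = 6 / 8 * (C * 2 ^ (2 * n + 7) * (hnorm w / A) / A ^ (2 * n + 3)) := by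
          rw [div_pow, div_pow, show 2 * n + 5 = (2 * n + 3) + 2 by ring,
            show 2 * n + 4 = (2 * n + 3) + 1 by ring, show 2 * n + 7 = (2 * n + 3) + 4 by ring]
          generalize 2 * n + 3 = m
          simp only [pow_add]
          field_simp
          ring
      _ ≤ C * 2 ^ (2 * n + 7) * (hnorm w / A) / A ^ (2 * n + 3) :=
          mul_le_of_le_one_left (by positivity) (by norm_num)
  have h := norm_image_sub_le_of_norm_deriv_le_segment_01'
    (fun s _ => (hderiv s).hasDerivWithinAt) hbound
  simpa [hv] using h

end IsHeisMolecule

end Smooth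

section Convolution

variable {n : ℕ}

lemma hconv_eq_hconv_neg {f h : Heis n → ℝ} (hf : Continuous f) (hh : Continuous h) (g : Heis n) :
    hconv f h g = hconv (fun u => h (-u)) (fun u => f (-u)) (-g) := by
  have hF : Continuous fun u : Heis n => h (-u) * f (-hmul (hinv u) (-g)) :=
    (hh.comp continuous_neg).mul (hf.comp (continuous_hmul_hinv (-g)).neg)
  have h1 := integral_comp_hmul_hinv hF 0
  have h2 := integral_comp_hmul_hinv
    (F := fun u : Heis n => h (- -u) * f (-hmul (hinv (-u)) (-g))) (hF.comp continuous_neg) g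
  simp only [hmul_hinv_zero] at h1
  rw [hconv, hconv, ← h1, ← h2]
  refine integral_congr_ae (Filter.Eventually.of_forall fun w => ?_)
  simp only [hinv_hmul, neg_neg]
  have h3 := hmul_hinv_cancel_left g w
  rw [hinv_eq_neg] at h3
  rw [h3, mul_comm, ← hinv_hmul, neg_neg]

lemma hdilNorm_comp_neg (r : ℝ) (f : Heis n → ℝ) :
    (fun u => hdilNorm r f (-u)) = hdilNorm r fun u => f (-u) := by
  ext u
  simp only [hdilNorm, hdil_neg]

lemma continuous_hdilNorm {f : Heis n → ℝ} (hf : Continuous f) (r : ℝ) :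
    Continuous (hdilNorm r f) :=
  continuous_const.mul (hf.comp (continuous_hdil r))

lemma hconv_hdilNorm_mul {f h : Heis n → ℝ} (hf : Continuous f) (hh : Continuous h) {r s : ℝ}
    (hs : 0 < s) (g : Heis n) :
    hconv (hdilNorm (r * s) f) (hdilNorm s h) g =
      s ^ (2 * n + 2) * hconv (hdilNorm r f) h (hdil s g) := by
  have hF : Continuous fun w => hdilNorm r f w * h (hmul (hinv w) (hdil s g)) :=
    (continuous_hdilNorm hf r).mul (hh.comp (continuous_hmul_hinv _))
  have h1 := integral_comp_hdil hF hs
  have h2 : ∀ w, hdilNorm (r * s) f w * hdilNorm s h (hmul (hinv w) g) =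
      (s ^ (2 * n + 2) * s ^ (2 * n + 2)) *
        (hdilNorm r f (hdil s w) * h (hmul (hinv (hdil s w)) (hdil s g))) := by
    intro w
    simp only [hdilNorm, hdil_hdil, hdil_hmul_hinv, mul_pow]
    ring
  have hpos : 0 < s ^ (2 * n + 2) := by positivity
  simp only [hconv, h2]
  rw [integral_const_mul, h1]
  field_simp

variable {C ε : ℝ} {f h : Heis n → ℝ}

/-- The integrable weight dominating molecules. -/
noncomputable def heisWeight (n : ℕ) (ε : ℝ) (g : Heis n) : ℝ :=
  (1 + hnorm g) ^ (-(2 * (n : ℝ) + 3 - ε))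

lemma heisWeight_nonneg (g : Heis n) : 0 ≤ heisWeight n ε g :=
  Real.rpow_nonneg (add_nonneg one_pos.le (hnorm_nonneg g)) _

lemma continuous_heisWeight : Continuous (heisWeight n ε) := continuous_one_add_hnorm_rpow _

lemma integrable_heisWeight (hε1 : ε < 1) : Integrable (heisWeight n ε) :=
  integrable_one_add_hnorm_rpow (by linarith)

lemma heisWeight_eq (g : Heis n) :
    heisWeight n ε g = (1 + hnorm g) ^ ε / (1 + hnorm g) ^ (2 * n + 3) := by
  have h := add_pos_of_pos_of_nonneg one_pos (hnorm_nonneg g)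
  rw [heisWeight, neg_sub, Real.rpow_sub h]
  congr 1
  rw [← Real.rpow_natCast]
  push_cast
  rfl

namespace IsHeisMolecule

lemma abs_le_weight (hf : IsHeisMolecule C f) (hC : 0 < C) (hε : 0 < ε) (g : Heis n) :
    |f g| ≤ C * heisWeight n ε g := by
  have h0 := hnorm_nonneg g
  rw [heisWeight_eq, ← mul_div_assoc]
  refine (hf.abs_le g).trans ?_
  gcongr
  exact le_mul_of_one_le_right hC.le (Real.one_le_rpow (by linarith) hε.le)

lemma integrable (hf : IsHeisMolecule C f) (hC : 0 < C) : Integrable f :=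
  ((integrable_heisWeight (ε := 1 / 2) (by norm_num)).const_mul C).mono'
    hf.continuous.aestronglyMeasurable
    (Filter.Eventually.of_forall fun g => hf.abs_le_weight hC (by norm_num) g)

lemma hdil_abs_mul_rpow_le (hf : IsHeisMolecule C f) (hC : 0 < C) (hε : 0 < ε) {r : ℝ} (hr : 0 < r)
    (w : Heis n) :
    |f (hdil r w)| * hnorm w ^ ε ≤ C * r ^ (-ε) * heisWeight n ε (hdil r w) := by
  have h0 := hnorm_nonneg (hdil r w)
  have hw : hnorm w = r⁻¹ * hnorm (hdil r w) := by rw [hnorm_hdil r hr.le]; field_simp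
  rw [hw, Real.mul_rpow (by positivity) h0, Real.inv_rpow hr.le, ← Real.rpow_neg hr.le,
    heisWeight_eq]
  calc |f (hdil r w)| * (r ^ (-ε) * hnorm (hdil r w) ^ ε)
      ≤ C / (1 + hnorm (hdil r w)) ^ (2 * n + 3) * (r ^ (-ε) * (1 + hnorm (hdil r w)) ^ ε) := by
        gcongr
        · exact hf.abs_le _
        · linarith
    _ = _ := by ring

/-- Pointwise bound for the cancellation-corrected convolution integrand. -/
lemma abs_hdilNorm_mul_sub_le (hf : IsHeisMolecule C f) (hh : IsHeisMolecule C h) (hC : 0 < C)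
    (hε : 0 < ε) (hε1 : ε < 1) {r : ℝ} (hr : 1 ≤ r) (w g : Heis n) :
    |hdilNorm r f w * (h (hmul (hinv w) g) - h g)| ≤
      C ^ 2 * 2 ^ (2 * n + 7) * r ^ (-ε) / (1 + hnorm g) ^ (2 * n + 3) *
        (r ^ (2 * n + 2) * heisWeight n ε (hdil r w) + heisWeight n ε (hmul (hinv w) g)) := by
  have hg0 := hnorm_nonneg g
  have hw0 := hnorm_nonneg w
  have hr0 : 0 < r := by linarith
  set A := 1 + hnorm g with hA
  have hA1 : 1 ≤ A := by linarith
  have hA0 : 0 < A := by linarith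
  set D := C * 2 ^ (2 * n + 7) with hD
  have hW := heisWeight_nonneg (ε := ε) (hmul (hinv w) g)
  have hW' := heisWeight_nonneg (ε := ε) (hdil r w)
  have hfw := hf.hdil_abs_mul_rpow_le hC hε hr0 w
  have hmain : ∀ x : ℝ, |x| ≤ D * hnorm w ^ ε / A ^ (2 * n + 3) →
      |hdilNorm r f w * x| ≤ C ^ 2 * 2 ^ (2 * n + 7) * r ^ (-ε) / A ^ (2 * n + 3) *
        (r ^ (2 * n + 2) * heisWeight n ε (hdil r w)) := by
    intro x hx
    calc |hdilNorm r f w * x| = r ^ (2 * n + 2) * |f (hdil r w)| * |x| := by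
          rw [hdilNorm, abs_mul, abs_mul, abs_of_nonneg (by positivity : 0 ≤ r ^ (2 * n + 2))]
      _ ≤ r ^ (2 * n + 2) * |f (hdil r w)| * (D * hnorm w ^ ε / A ^ (2 * n + 3)) := by gcongr
      _ = D * r ^ (2 * n + 2) / A ^ (2 * n + 3) * (|f (hdil r w)| * hnorm w ^ ε) := by ring
      _ ≤ D * r ^ (2 * n + 2) / A ^ (2 * n + 3) *
            (C * r ^ (-ε) * heisWeight n ε (hdil r w)) := by gcongr
      _ = _ := by rw [hD]; ring
  rw [mul_add]
  rcases le_or_gt (hnorm w) (A / 2) with hnear | hfar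
  · refine le_add_of_le_of_nonneg (hmain _ ((hh.abs_translate_sub_le hC hnear).trans ?_))
      (by positivity)
    gcongr
    calc hnorm w / A ≤ (hnorm w / A) ^ (1 : ℝ) := (Real.rpow_one _).ge
      _ ≤ (hnorm w / A) ^ ε :=
          Real.rpow_le_rpow_of_exponent_ge' (by positivity)
            ((div_le_one hA0).2 (by linarith)) hε.le hε1.le
      _ ≤ hnorm w ^ ε := by
          gcongr
          exact div_le_self hw0 hA1
  · rw [mul_sub]
    refine (abs_sub _ _).trans ?_
    rw [add_comm]
    refine add_le_add (hmain _ ((hh.abs_le g).trans ?_)) ?_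
    · gcongr
      rw [hD, mul_assoc]
      refine le_mul_of_one_le_right hC.le ?_
      have h1 : (1 / 2 : ℝ) ≤ hnorm w ^ ε := calc
        (1 / 2 : ℝ) = (1 / 2 : ℝ) ^ (1 : ℝ) := (Real.rpow_one _).symm
        _ ≤ (1 / 2 : ℝ) ^ ε :=
            Real.rpow_le_rpow_of_exponent_ge (by norm_num) (by norm_num) hε1.le
        _ ≤ hnorm w ^ ε := by
            gcongr
            linarith
      have h2 : (2 : ℝ) ≤ 2 ^ (2 * n + 7) := by
        simpa using pow_le_pow_right₀ (one_le_two (α := ℝ)) (by omega : 1 ≤ 2 * n + 7)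
      nlinarith
    · have hrA : r * A / 2 ≤ 1 + hnorm (hdil r w) := by
        rw [hnorm_hdil r hr0.le]
        nlinarith
      have h1 : |hdilNorm r f w| ≤ D * r ^ (-ε) / A ^ (2 * n + 3) := calc
        |hdilNorm r f w| = r ^ (2 * n + 2) * |f (hdil r w)| := by
            rw [hdilNorm, abs_mul, abs_of_nonneg (by positivity : 0 ≤ r ^ (2 * n + 2))]
        _ ≤ r ^ (2 * n + 2) * (C / (r * A / 2) ^ (2 * n + 3)) := by
            gcongr
            exact (hf.abs_le _).trans (by gcongr)
        _ = C * 2 ^ (2 * n + 3) * r⁻¹ / A ^ (2 * n + 3) := by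
            rw [div_pow, mul_pow, show 2 * n + 3 = (2 * n + 2) + 1 by ring]
            generalize 2 * n + 2 = m
            rw [pow_succ r]
            field_simp
        _ ≤ D * r ^ (-ε) / A ^ (2 * n + 3) := by
            rw [hD, ← Real.rpow_neg_one r]
            gcongr
            · norm_num
            · omega
      calc |hdilNorm r f w * h (hmul (hinv w) g)|
          = |hdilNorm r f w| * |h (hmul (hinv w) g)| := abs_mul _ _
        _ ≤ D * r ^ (-ε) / A ^ (2 * n + 3) * (C * heisWeight n ε (hmul (hinv w) g)) := by
            gcongr
            exact hh.abs_le_weight hC hε _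
        _ = _ := by rw [hD]; ring

lemma abs_hconv_hdilNorm_le (hf : IsHeisMolecule C f) (hh : IsHeisMolecule C h) (hC : 0 < C)
    (hε : 0 < ε) (hε1 : ε < 1) {r : ℝ} (hr : 1 ≤ r) (g : Heis n) :
    |hconv (hdilNorm r f) h g| ≤
      C ^ 2 * 2 ^ (2 * n + 8) * (∫ w, heisWeight n ε w) * r ^ (-ε) /
        (1 + hnorm g) ^ (2 * n + 3) := by
  have hr0 : 0 < r := by linarith
  have hfint : Integrable (hdilNorm r f) :=
    (integrable_comp_hdil (hf.integrable hC) hr0).const_mul _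
  have hf0 : ∫ w, hdilNorm r f w = 0 := by
    simp only [hdilNorm]
    rw [integral_const_mul, integral_comp_hdil hf.continuous hr0, hf.integral_eq_zero]
    simp
  have hbdd : ∀ u, ‖h u‖ ≤ C := fun u =>
    (hh.abs_le u).trans (div_le_self hC.le
      (one_le_pow₀ (le_add_of_nonneg_right (hnorm_nonneg u))))
  have hprod : Integrable fun w => hdilNorm r f w * h (hmul (hinv w) g) :=
    hfint.mul_bdd (hh.continuous.comp (continuous_hmul_hinv g)).aestronglyMeasurable
      (Filter.Eventually.of_forall fun w => hbdd _)
  have hcancel : hconv (hdilNorm r f) h g =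
      ∫ w, hdilNorm r f w * (h (hmul (hinv w) g) - h g) := by
    simp only [mul_sub]
    rw [integral_sub hprod (hfint.mul_const _), integral_mul_const, hf0, zero_mul, sub_zero]
    rfl
  have hw := integrable_heisWeight (n := n) hε1
  have hw1 : Integrable fun w : Heis n => r ^ (2 * n + 2) * heisWeight n ε (hdil r w) :=
    (integrable_comp_hdil hw hr0).const_mul _
  have hw2 : Integrable fun w : Heis n => heisWeight n ε (hmul (hinv w) g) :=
    integrable_comp_hmul_hinv hw g
  have hw12 : Integrable fun w : Heis n =>
      r ^ (2 * n + 2) * heisWeight n ε (hdil r w) + heisWeight n ε (hmul (hinv w) g) := hw1.add hw2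
  rw [hcancel]
  refine (norm_integral_le_of_norm_le
    (f := fun w => hdilNorm r f w * (h (hmul (hinv w) g) - h g))
    (hw12.const_mul (C ^ 2 * 2 ^ (2 * n + 7) * r ^ (-ε) / (1 + hnorm g) ^ (2 * n + 3)))
    (Filter.Eventually.of_forall fun w =>
      hf.abs_hdilNorm_mul_sub_le hh hC hε hε1 hr w g)).trans_eq ?_
  have hpos : 0 < r ^ (2 * n + 2) := by positivity
  rw [integral_const_mul, integral_add hw1 hw2, integral_const_mul,
    integral_comp_hdil continuous_heisWeight hr0, integral_comp_hmul_hinv continuous_heisWeight, mul_inv_cancel_left₀ hpos.ne',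
    show 2 * n + 8 = (2 * n + 7) + 1 by ring, pow_succ (2 : ℝ)]
  ring

lemma abs_hconv_hdilNorm_hdilNorm_le (hf : IsHeisMolecule C f) (hh : IsHeisMolecule C h)
    (hC : 0 < C) (hε : 0 < ε) (hε1 : ε < 1) {r s : ℝ} (hr : 1 ≤ r) (hs : 0 < s) (g : Heis n) :
    |hconv (hdilNorm (r * s) f) (hdilNorm s h) g| ≤
      C ^ 2 * 2 ^ (2 * n + 8) * (∫ w, heisWeight n ε w) * r ^ (-ε) *
        (s⁻¹ / (s⁻¹ + hnorm g) ^ (2 * n + 3)) := by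
  have hg0 := hnorm_nonneg g
  rw [hconv_hdilNorm_mul hf.continuous hh.continuous hs, abs_mul,
    abs_of_nonneg (by positivity : 0 ≤ s ^ (2 * n + 2))]
  refine (mul_le_mul_of_nonneg_left
    (hf.abs_hconv_hdilNorm_le hh hC hε hε1 hr (hdil s g)) (by positivity)).trans_eq ?_
  have h1 : 1 + hnorm (hdil s g) = s * (s⁻¹ + hnorm g) := by
    rw [hnorm_hdil s hs.le]; field_simp
  rw [h1, mul_pow, pow_succ s (2 * n + 2)]
  field_simp

end IsHeisMolecule

end Convolution

theorem stmt6 (n : ℕ) (hn : 1 ≤ n) (φ ϕ : Heis n → ℝ) (C₀ : ℝ) (hC₀ : 0 < C₀)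
    (hφsm : ContDiff ℝ 1 φ) (hϕsm : ContDiff ℝ 1 ϕ)
    (hφint : (∫ g, φ g) = 0) (hϕint : (∫ g, ϕ g) = 0)
    (hφ0 : ∀ g : Heis n, |φ g| ≤ C₀ / (1 + hnorm g) ^ (2 * n + 3))
    (hϕ0 : ∀ g : Heis n, |ϕ g| ≤ C₀ / (1 + hnorm g) ^ (2 * n + 3))
    (hφz : ∀ g : Heis n, zgrad φ g ≤ C₀ / (1 + hnorm g) ^ (2 * n + 4))
    (hϕz : ∀ g : Heis n, zgrad ϕ g ≤ C₀ / (1 + hnorm g) ^ (2 * n + 4))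
    (hφt : ∀ g : Heis n, |tderiv φ g| ≤ C₀ / (1 + hnorm g) ^ (2 * n + 5))
    (hϕt : ∀ g : Heis n, |tderiv ϕ g| ≤ C₀ / (1 + hnorm g) ^ (2 * n + 5)) :
    ∀ ε : ℝ, 0 < ε → ε < 1 → ∃ C : ℝ, 0 < C ∧
      ∀ (j j' : ℤ) (g : Heis n),
        |hconv (hdilNorm ((2 : ℝ) ^ j) φ) (hdilNorm ((2 : ℝ) ^ j') ϕ) g| ≤
          C * (2 : ℝ) ^ (-(((j - j').natAbs : ℝ)) * ε) *
            ((2 : ℝ) ^ (-(min j j')) / ((2 : ℝ) ^ (-(min j j')) + hnorm g) ^ (2 * n + 3)) := by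
  intro ε hε hε1
  have hφ : IsHeisMolecule C₀ φ := ⟨hφsm, hφint, hφ0, hφz, hφt⟩
  have hϕ : IsHeisMolecule C₀ ϕ := ⟨hϕsm, hϕint, hϕ0, hϕz, hϕt⟩
  have hM : 0 ≤ ∫ w, heisWeight n ε w := integral_nonneg heisWeight_nonneg
  set K := C₀ ^ 2 * 2 ^ (2 * n + 8) * (∫ w, heisWeight n ε w) with hK
  have hK0 : 0 ≤ K := by positivity
  have hpow : ∀ k : ℕ, ((2 : ℝ) ^ (k : ℤ)) ^ (-ε) = (2 : ℝ) ^ (-(k : ℝ) * ε) := by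
    intro k
    rw [zpow_natCast, ← Real.rpow_natCast, ← Real.rpow_mul zero_le_two, mul_neg, neg_mul]
  have hle : ∀ a : ℝ, 0 ≤ a → ∀ b : ℝ, 0 ≤ b → K * a * b ≤ (K + 1) * a * b := by
    intro a ha b hb
    gcongr
    linarith
  refine ⟨K + 1, by positivity, fun j j' g => ?_⟩
  have hg0 := hnorm_nonneg g
  refine le_trans ?_ (hle _ (by positivity) _ (by positivity))
  rcases le_total j' j with hj | hj
  · obtain ⟨k, rfl⟩ := Int.le.dest hj
    rw [min_eq_right hj, add_sub_cancel_left, Int.natAbs_natCast, ← hpow, zpow_neg, add_comm j',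
      zpow_add₀ two_ne_zero]
    exact hφ.abs_hconv_hdilNorm_hdilNorm_le hϕ hC₀ hε hε1
      (by rw [zpow_natCast]; exact one_le_pow₀ one_le_two) (by positivity) g
  · obtain ⟨k, rfl⟩ := Int.le.dest hj
    rw [min_eq_left hj, sub_add_cancel_left, Int.natAbs_neg, Int.natAbs_natCast, ← hpow, zpow_neg,
      add_comm j, zpow_add₀ two_ne_zero, hconv_eq_hconv_neg (continuous_hdilNorm hφ.continuous _)
      (continuous_hdilNorm hϕ.continuous _), hdilNorm_comp_neg, hdilNorm_comp_neg, ← hnorm_neg g]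
    exact hϕ.comp_neg.abs_hconv_hdilNorm_hdilNorm_le hφ.comp_neg hC₀ hε hε1
      (by rw [zpow_natCast]; exact one_le_pow₀ one_le_two) (by positivity) (-g)
end

section
/- (Key flag almost-orthogonality lemma.) Let K be a measurable function on ℍ^n \ {0}, C¹ away from 0, satisfying |K(g)| ≤ C₀ ρ(g)^{−2n−2}, |∇_z K(g)| ≤ C₀ ρ(g)^{−2n−3}, |∂K/∂t(g)| ≤ C₀ ρ(g)^{−2n−4} for g ≠ 0, and the cancellation condition: for every normalized bump function φ, every r > 0 and every η > 0, |∫_{ρ(g) > η} K(g) φ(δ_r(g)) dg| ≤ C₀. Let ψ^{(1)} be a smooth function on ℍ^n supported in the ρ-ball {ρ(g) ≤ c₀} for a suitable small constant c₀ = c₀(n) ∈ (0,1) with ∫_{ℍ^n} ψ^{(1)} = 0, and let ψ^{(2)} ∈ 𝒮(ℝ) with ∫_ℝ ψ^{(2)}(u) du = 0 and ∫_ℝ u ψ^{(2)}(u) du = 0. Set ψ^{(1)}_j(g) := 2^{j(2n+2)} ψ^{(1)}(δ_{2^j}(g)), ψ^{(2)}_k(u) := 2^k ψ^{(2)}(2^k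 u), and ψ_{j,k}(z,t) := ∫_ℝ ψ^{(1)}_j(z, t−u) ψ^{(2)}_k(u) du. Assume the principal-value convolutions ψ_{j,k} ∗ K ∗ ψ_{j',k'} exist. Then for every ε ∈ (0,1) there is a constant C such that for all j, j', k, k' ∈ ℤ and all (z,t) ∈ ℂ^n × ℝ: if 2(j∧j') ≥ k∧k', then |(ψ_{j,k} ∗ K ∗ ψ_{j',k'})(z,t)| ≤ C · 2^{−|j−j'|ε} 2^{−|k−k'|} · [2^{−(j∧j')/2} / (2^{−(j∧j')} + |z|)^{2n+1/2}] · [2^{−(k∧k')/4} / (2^{−(k∧k')} + |t|)^{5/4}]; and if 2(j∧j') ≤ k∧k', then |(ψ_{j,k} ∗ K ∗ ψ_{j',k'})(z,t)| ≤ C · 2^{−|j−j'|ε} 2^{−|k−k'|} · [2^{−(j∧j')/2} / (2^{−(j∧j')} + |z|)^{2n+1/2}] · [2^{−(j∧j')/2} / (2^{−(j∧j')} + |t|^{1/2})^{5/2}]. -/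
open MeasureTheory Filter

/-- The `i`-th coordinate direction in `ℝ^{2n+1}`. -/
def evec {n : ℕ} (i : Fin (2 * n + 1)) : Heis n :=
  if h : (i : ℕ) < n then (Pi.single ⟨i, h⟩ 1, 0, 0)
  else if h2 : (i : ℕ) < 2 * n then (0, Pi.single ⟨(i : ℕ) - n, by omega⟩ 1, 0)
  else (0, 0, 1)

/-- The `i`-th coordinate partial derivative `∂/∂(z,t)_i`. -/
noncomputable def pop {n : ℕ} (i : Fin (2 * n + 1)) (f : Heis n → ℝ) (g : Heis n) : ℝ :=
  fderiv ℝ f g (evec i)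

/-- `∂^I_{z,t} = ∂₁^{i₁} ∂₂^{i₂} ⋯ ∂_{2n+1}^{i_{2n+1}}` for a multi-index `I`. -/
noncomputable def piter {n : ℕ} (I : Fin (2 * n + 1) → ℕ) (f : Heis n → ℝ) : Heis n → ℝ :=
  (List.finRange (2 * n + 1)).foldr (fun i F => (pop i)^[I i] F) f

/-- A normalized bump function on `ℍⁿ`: smooth, supported in the unit ball
`{ρ(g) ≤ 1}`, with `|∂^I_{z,t} φ| ≤ 1` for all multi-indices `I` with `|I| ≤ N`. -/
def IsBump (n N : ℕ) (φ : Heis n → ℝ) : Prop :=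
  ContDiff ℝ (⊤ : ℕ∞) φ ∧ Function.support φ ⊆ {g : Heis n | hnorm g ≤ 1} ∧
    ∀ I : Fin (2 * n + 1) → ℕ, (∑ i, I i) ≤ N → ∀ g : Heis n, |piter I φ g| ≤ 1

/-- The Calderón–Zygmund conditions on a convolution kernel `K` on `ℍⁿ`:
size and smoothness estimates away from the origin, together with uniform
cancellation against dilated normalized bump functions (with truncations). -/
def IsCZKernel (n N : ℕ) (K : Heis n → ℝ) (C₀ : ℝ) : Prop :=
  ContDiffOn ℝ 1 K {g : Heis n | g ≠ 0} ∧
  (∀ g : Heis n, g ≠ 0 → |K g| ≤ C₀ / hnorm g ^ (2 * n + 2)) ∧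
  (∀ g : Heis n, g ≠ 0 → zgrad K g ≤ C₀ / hnorm g ^ (2 * n + 3)) ∧
  (∀ g : Heis n, g ≠ 0 → |tderiv K g| ≤ C₀ / hnorm g ^ (2 * n + 4)) ∧
  (∀ φ : Heis n → ℝ, IsBump n N φ → ∀ r : ℝ, 0 < r → ∀ η : ℝ, 0 < η →
    |∫ g in {g : Heis n | η < hnorm g}, K g * φ (hdil r g)| ≤ C₀)

/-- The flag component function `ψ_{j,k}(z,t) = ∫ ψ^{(1)}_j (z, t−u) ψ^{(2)}_k(u) du`,
where `ψ^{(1)}_j = D_{2^j} ψ^{(1)}` and `ψ^{(2)}_k(u) = 2^k ψ^{(2)}(2^k u)`. -/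
noncomputable def psijk {n : ℕ} (ψ1 : Heis n → ℝ) (ψ2 : ℝ → ℝ) (j k : ℤ) (g : Heis n) : ℝ :=
  ∫ u : ℝ, hdilNorm ((2 : ℝ) ^ j) ψ1 (g.1, g.2.1, g.2.2 - u) *
    ((2 : ℝ) ^ k * ψ2 ((2 : ℝ) ^ k * u))

namespace HeisFlag

variable {n : ℕ}

/-! ### The Heisenberg group and its homogeneous norm -/

/-- Translation by `-s` in the central variable. -/
def tsh (s : ℝ) (g : Heis n) : Heis n := (g.1, g.2.1, g.2.2 - s)

lemma hmul_assoc (a b c : Heis n) : hmul (hmul a b) c = hmul a (hmul b c) := by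
  refine Prod.ext (add_assoc _ _ _) (Prod.ext (add_assoc _ _ _) ?_)
  simp only [hmul, Pi.add_apply, add_mul, mul_add, Finset.sum_add_distrib]
  ring

lemma hinv_hmul_cancel (a b : Heis n) : hmul (hinv a) (hmul a b) = b := by
  refine Prod.ext (by simp [hmul, hinv]) (Prod.ext (by simp [hmul, hinv]) ?_)
  simp only [hmul, hinv, Pi.add_apply, Pi.neg_apply, neg_mul, mul_add, add_mul, Finset.sum_add_distrib,
    Finset.sum_neg_distrib, mul_comm, mul_neg]
  ring

lemma hmul_hinv_cancel (a b : Heis n) : hmul a (hmul (hinv a) b) = b := by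
  refine Prod.ext (by simp [hmul, hinv]) (Prod.ext (by simp [hmul, hinv]) ?_)
  simp only [hmul, hinv, Pi.add_apply, Pi.neg_apply, neg_mul, mul_add, add_mul, Finset.sum_add_distrib,
    Finset.sum_neg_distrib, mul_comm, mul_neg]
  ring

lemma hinv_hinv (a : Heis n) : hinv (hinv a) = a := by simp [hinv]

lemma hinv_eq_neg (a : Heis n) : hinv a = -a := rfl

lemma hinv_hmul (a b : Heis n) : hinv (hmul a b) = hmul (hinv b) (hinv a) := by
  refine Prod.ext (by simp [hmul, hinv]) (Prod.ext (by simp [hmul, hinv]) ?_)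
  simp only [hmul, hinv, Pi.neg_apply, neg_mul, mul_neg, neg_neg, mul_comm]
  ring

lemma hmul_hinv_hmul_cancel (a b : Heis n) : hmul (hmul a (hinv b)) b = a := by
  have := congrArg hinv (hmul_hinv_cancel (hinv b) (hinv a))
  simpa only [hinv_hmul, hinv_hinv, hmul_assoc] using this

lemma hmul_hmul_hinv_cancel (a b : Heis n) : hmul (hmul a b) (hinv b) = a := by
  simpa only [hinv_hinv] using hmul_hinv_hmul_cancel a (hinv b)

lemma hmul_tsh_left (s : ℝ) (a b : Heis n) : hmul (tsh s a) b = tsh s (hmul a b) :=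
  Prod.ext rfl (Prod.ext rfl (by simp only [hmul, tsh]; ring))

lemma hmul_tsh_right (s : ℝ) (a b : Heis n) : hmul a (tsh s b) = tsh s (hmul a b) :=
  Prod.ext rfl (Prod.ext rfl (by simp only [hmul, tsh]; ring))

lemma hinv_tsh (s : ℝ) (a : Heis n) : hinv (tsh s a) = tsh (-s) (hinv a) :=
  Prod.ext rfl (Prod.ext rfl (by simp only [hinv, tsh]; ring))

lemma tsh_tsh (s s' : ℝ) (a : Heis n) : tsh s (tsh s' a) = tsh (s + s') a :=
  Prod.ext rfl (Prod.ext rfl (by simp only [tsh]; ring))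

lemma tsh_zero (a : Heis n) : tsh 0 a = a :=
  Prod.ext rfl (Prod.ext rfl (by simp only [tsh]; ring))

lemma hdil_hmul (r : ℝ) (a b : Heis n) : hdil r (hmul a b) = hmul (hdil r a) (hdil r b) := by
  refine Prod.ext (by simp [hmul, hdil]) (Prod.ext (by simp [hmul, hdil]) ?_)
  simp only [hmul, hdil, Pi.smul_apply, smul_eq_mul]
  have e : ∀ p q : Fin n → ℝ, ∑ i, r * p i * (r * q i) = r ^ 2 * ∑ i, p i * q i := by
    intro p q
    rw [Finset.mul_sum]
    exact Finset.sum_congr rfl fun i _ => by ring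
  rw [e, e]
  ring

lemma hdil_hinv (r : ℝ) (a : Heis n) : hdil r (hinv a) = hinv (hdil r a) := by
  simp [hdil, hinv]

lemma hdil_hdil (r s : ℝ) (a : Heis n) : hdil r (hdil s a) = hdil (r * s) a := by
  simp only [hdil, smul_smul, mul_pow, mul_assoc]

lemma hmul_zero (a : Heis n) : hmul a 0 = a := by simp [hmul]

lemma hinv_zero : hinv (0 : Heis n) = 0 := by simp [hinv]

lemma abs_sum_add_sum_le (p q p' q' : Fin n → ℝ) :
    |∑ i, p i * p' i + ∑ i, q i * q' i| ≤
      √(∑ i, p i ^ 2 + ∑ i, q i ^ 2) * √(∑ i, p' i ^ 2 + ∑ i, q' i ^ 2) := by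
  have := Finset.sum_mul_sq_le_sq_mul_sq (Finset.univ : Finset (Fin n ⊕ Fin n))
    (Sum.elim p q) (Sum.elim p' q')
  simp only [Fintype.sum_sum_type, Sum.elim_inl, Sum.elim_inr] at this
  rw [← Real.sqrt_mul (by positivity)]
  exact Real.abs_le_sqrt this

lemma znorm_nonneg (g : Heis n) : 0 ≤ znorm g := Real.sqrt_nonneg _

lemma znorm_sq (g : Heis n) : znorm g ^ 2 = ∑ i, g.1 i ^ 2 + ∑ i, g.2.1 i ^ 2 :=
  Real.sq_sqrt (by positivity)

lemma hnorm_nonneg (g : Heis n) : 0 ≤ hnorm g := le_max_of_le_left (znorm_nonneg g)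

lemma znorm_le_hnorm (g : Heis n) : znorm g ≤ hnorm g := le_max_left _ _

lemma sqrt_le_hnorm (g : Heis n) : √|g.2.2| ≤ hnorm g := le_max_right _ _

lemma abs_le_hnorm_sq (g : Heis n) : |g.2.2| ≤ hnorm g ^ 2 := by
  have := pow_le_pow_left₀ (Real.sqrt_nonneg _) (sqrt_le_hnorm g) 2
  rwa [Real.sq_sqrt (abs_nonneg _)] at this

lemma hnorm_le_of (g : Heis n) {R : ℝ} (hR : 0 ≤ R) (h1 : znorm g ≤ R) (h2 : |g.2.2| ≤ R ^ 2) :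
    hnorm g ≤ R :=
  max_le h1 (Real.sqrt_le_iff.2 ⟨hR, h2⟩)

lemma znorm_neg (g : Heis n) : znorm (-g) = znorm g := by simp [znorm]

lemma hnorm_neg (g : Heis n) : hnorm (-g) = hnorm g := by simp [hnorm, znorm_neg]

lemma hnorm_hinv (g : Heis n) : hnorm (hinv g) = hnorm g := hnorm_neg g

lemma hnorm_zero : hnorm (0 : Heis n) = 0 := by simp [hnorm, znorm]

lemma ne_zero_of_hnorm_pos {g : Heis n} (h : 0 < hnorm g) : g ≠ 0 := by
  rintro rfl
  simp [hnorm_zero] at h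

lemma continuous_znorm : Continuous (znorm : Heis n → ℝ) := by
  unfold znorm; fun_prop

lemma continuous_hnorm : Continuous (hnorm : Heis n → ℝ) := by
  unfold hnorm; exact continuous_znorm.max (by fun_prop)

lemma abs_symp_le (g g' : Heis n) :
    |∑ i, g.2.1 i * g'.1 i - ∑ i, g.1 i * g'.2.1 i| ≤ znorm g * znorm g' := by
  have := abs_sum_add_sum_le g.2.1 (-g.1) g'.1 g'.2.1
  simp only [Pi.neg_apply, neg_mul, Finset.sum_neg_distrib, ← sub_eq_add_neg, neg_sq] at this
  rwa [add_comm (∑ i, g.2.1 i ^ 2)] at this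

lemma znorm_hmul_le (g g' : Heis n) : znorm (hmul g g') ≤ znorm g + znorm g' := by
  have h := abs_le.1 (abs_sum_add_sum_le g.1 g.2.1 g'.1 g'.2.1)
  change _ ∧ _ ≤ znorm g * znorm g' at h
  refine abs_le_of_sq_le_sq' ?_ (add_nonneg (znorm_nonneg _) (znorm_nonneg _)) |>.2
  rw [add_sq, znorm_sq, znorm_sq, znorm_sq]
  simp only [hmul, Pi.add_apply, add_sq, Finset.sum_add_distrib, mul_assoc, ← Finset.mul_sum]
  linarith [h.2]

lemma hnorm_hmul_le (g g' : Heis n) : hnorm (hmul g g') ≤ hnorm g + hnorm g' := by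
  refine hnorm_le_of _ (add_nonneg (hnorm_nonneg _) (hnorm_nonneg _))
    ((znorm_hmul_le g g').trans (add_le_add (znorm_le_hnorm _) (znorm_le_hnorm _))) ?_
  have h1 := abs_le_hnorm_sq g
  have h2 := abs_le_hnorm_sq g'
  have h3 := (abs_symp_le g g').trans
    (mul_le_mul (znorm_le_hnorm g) (znorm_le_hnorm g') (znorm_nonneg _) (hnorm_nonneg _))
  simp only [hmul]
  rw [abs_le] at *
  constructor <;> nlinarith

lemma hnorm_hdil {r : ℝ} (hr : 0 ≤ r) (g : Heis n) : hnorm (hdil r g) = r * hnorm g := by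
  have h1 : znorm (hdil r g) = r * znorm g := by
    simp only [znorm, hdil, Pi.smul_apply, smul_eq_mul, mul_pow, ← Finset.mul_sum, ← mul_add]
    rw [Real.sqrt_mul (by positivity), Real.sqrt_sq hr]
  have h2 : √|(hdil r g).2.2| = r * √|g.2.2| := by
    simp only [hdil, abs_mul, abs_pow, sq_abs]
    rw [Real.sqrt_mul (by positivity), Real.sqrt_sq hr]
  rw [hnorm, h1, h2, hnorm, mul_max_of_nonneg _ _ hr]

lemma norm_le_of_hnorm_le {g : Heis n} {R : ℝ} (hg : hnorm g ≤ R) : ‖g‖ ≤ max R (R ^ 2) := by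
  have hR := (hnorm_nonneg g).trans hg
  have hz := (znorm_le_hnorm g).trans hg
  have hzz := pow_le_pow_left₀ (znorm_nonneg g) hz 2
  rw [znorm_sq] at hzz
  have key1 : ∀ i, g.1 i ^ 2 ≤ R ^ 2 := fun i => by
    have := Finset.single_le_sum (f := fun i => g.1 i ^ 2) (fun i _ => sq_nonneg _)
      (Finset.mem_univ i)
    have h2 : 0 ≤ ∑ i, g.2.1 i ^ 2 := by positivity
    linarith
  have key2 : ∀ i, g.2.1 i ^ 2 ≤ R ^ 2 := fun i => by
    have := Finset.single_le_sum (f := fun i => g.2.1 i ^ 2) (fun i _ => sq_nonneg _)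
      (Finset.mem_univ i)
    have h2 : 0 ≤ ∑ i, g.1 i ^ 2 := by positivity
    linarith
  refine norm_prod_le_iff.2 ⟨?_, norm_prod_le_iff.2 ⟨?_, ?_⟩⟩
  · exact (pi_norm_le_iff_of_nonneg (hR.trans (le_max_left _ _))).2 fun i =>
      (abs_le_of_sq_le_sq (key1 i) hR).trans (le_max_left _ _)
  · exact (pi_norm_le_iff_of_nonneg (hR.trans (le_max_left _ _))).2 fun i =>
      (abs_le_of_sq_le_sq (key2 i) hR).trans (le_max_left _ _)
  · exact ((abs_le_hnorm_sq g).trans (pow_le_pow_left₀ (hnorm_nonneg g) hg 2)).trans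
      (le_max_right _ _)

lemma isCompact_hnorm_le (R : ℝ) : IsCompact {g : Heis n | hnorm g ≤ R} := by
  refine (isCompact_closedBall (0 : Heis n) (max R (R ^ 2))).of_isClosed_subset
    (isClosed_le continuous_hnorm continuous_const) fun g hg => ?_
  rw [mem_closedBall_zero_iff]
  exact norm_le_of_hnorm_le hg

lemma contDiff_hmul {m : WithTop ℕ∞} :
    ContDiff ℝ m fun p : Heis n × Heis n => hmul p.1 p.2 := by
  unfold hmul; fun_prop

lemma contDiff_hinv {m : WithTop ℕ∞} : ContDiff ℝ m (hinv : Heis n → Heis n) := by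
  unfold hinv; fun_prop

lemma contDiff_hdil {m : WithTop ℕ∞} (r : ℝ) : ContDiff ℝ m (hdil r : Heis n → Heis n) := by
  unfold hdil; fun_prop

@[fun_prop]
lemma continuous_hmul {X : Type*} [TopologicalSpace X] {f g : X → Heis n} (hf : Continuous f)
    (hg : Continuous g) : Continuous fun x => hmul (f x) (g x) :=
  (contDiff_hmul (m := 0)).continuous.comp (hf.prodMk hg)

@[fun_prop]
lemma continuous_hinv {X : Type*} [TopologicalSpace X] {f : X → Heis n} (hf : Continuous f) :
    Continuous fun x => hinv (f x) :=
  (contDiff_hinv (m := 0)).continuous.comp hf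

@[fun_prop]
lemma continuous_tsh {X : Type*} [TopologicalSpace X] {s : X → ℝ} {f : X → Heis n}
    (hs : Continuous s) (hf : Continuous f) : Continuous fun x => tsh (s x) (f x) := by
  unfold tsh; fun_prop

@[fun_prop]
lemma continuous_hdil {X : Type*} [TopologicalSpace X] {r : X → ℝ} {f : X → Heis n}
    (hr : Continuous r) (hf : Continuous f) : Continuous fun x => hdil (r x) (f x) := by
  unfold hdil; fun_prop

/-! ### Measure preserving maps -/

instance : (volume : Measure (Heis n)).IsAddHaarMeasure := by
  have h : (volume : Measure ((Fin n → ℝ) × ℝ)).IsAddHaarMeasure :=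
    inferInstanceAs ((volume : Measure (Fin n → ℝ)).prod (volume : Measure ℝ)).IsAddHaarMeasure
  exact Measure.prod.instIsAddHaarMeasure (volume : Measure (Fin n → ℝ))
    (volume : Measure ((Fin n → ℝ) × ℝ))

lemma measurePreserving_shear (x₀ y₀ : Fin n → ℝ) {θ : (Fin n → ℝ) → (Fin n → ℝ) → ℝ}
    (hθ : Continuous fun p : (Fin n → ℝ) × (Fin n → ℝ) => θ p.1 p.2) :
    MeasurePreserving (fun g : Heis n => ((x₀ + g.1, y₀ + g.2.1, θ g.1 g.2.1 + g.2.2) : Heis n)) := by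
  refine MeasurePreserving.skew_product (f := fun x => x₀ + x)
    (g := fun x (p : (Fin n → ℝ) × ℝ) => (y₀ + p.1, θ x p.1 + p.2))
    (measurePreserving_add_left volume x₀) ?_ (ae_of_all _ fun x => ?_)
  · refine Continuous.measurable ?_
    have : Continuous fun p : (Fin n → ℝ) × (Fin n → ℝ) × ℝ => θ p.1 p.2.1 :=
      hθ.comp (f := fun p : (Fin n → ℝ) × (Fin n → ℝ) × ℝ => (p.1, p.2.1)) (by fun_prop)
    unfold Function.uncurry
    fun_prop
  · refine (MeasurePreserving.skew_product (f := fun y => y₀ + y)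
      (g := fun y t => θ x y + t) (μa := volume) (μb := volume) (μc := volume) (μd := volume)
      (measurePreserving_add_left volume y₀) ?_ (ae_of_all _ fun y => ?_)).map_eq
    · refine Continuous.measurable ?_
      have : Continuous fun p : (Fin n → ℝ) × ℝ => θ x p.1 :=
        hθ.comp (f := fun p : (Fin n → ℝ) × ℝ => (x, p.1)) (by fun_prop)
      unfold Function.uncurry
      fun_prop
    · exact (measurePreserving_add_left volume (θ x y)).map_eq

lemma measurePreserving_hmul_left (a : Heis n) : MeasurePreserving (hmul a) := by
  convert measurePreserving_shear a.1 a.2.1 (θ := fun x y =>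
    a.2.2 + 2 * (∑ i, a.2.1 i * x i) - 2 * (∑ i, a.1 i * y i)) (by fun_prop) using 2 with g
  refine Prod.ext rfl (Prod.ext rfl ?_)
  simp only [hmul]
  ring

lemma measurePreserving_hmul_right (a : Heis n) : MeasurePreserving (fun g => hmul g a) := by
  convert measurePreserving_shear a.1 a.2.1 (θ := fun x y =>
    a.2.2 + 2 * (∑ i, y i * a.1 i) - 2 * (∑ i, x i * a.2.1 i)) (by fun_prop) using 2 with g
  refine Prod.ext (add_comm _ _) (Prod.ext (add_comm _ _) ?_)
  simp only [hmul]
  ring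

lemma measurePreserving_hinv : MeasurePreserving (hinv : Heis n → Heis n) :=
  (Measure.measurePreserving_neg (volume : Measure (Fin n → ℝ))).prod
    ((Measure.measurePreserving_neg (volume : Measure (Fin n → ℝ))).prod
      (Measure.measurePreserving_neg (volume : Measure ℝ)))

lemma measurePreserving_tsh (s : ℝ) : MeasurePreserving (tsh s : Heis n → Heis n) := by
  convert measurePreserving_shear (0 : Fin n → ℝ) 0 (θ := fun x y => -s) (by fun_prop) using 2
    with g
  refine Prod.ext (zero_add _).symm (Prod.ext (zero_add _).symm ?_)
  simp only [tsh]
  ring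

/-- Left translation as a measurable equivalence. -/
def hmulLeftEquiv (a : Heis n) : Heis n ≃ᵐ Heis n where
  toFun := hmul a
  invFun := hmul (hinv a)
  left_inv := hinv_hmul_cancel a
  right_inv := hmul_hinv_cancel a
  measurable_toFun := (by fun_prop : Continuous fun g : Heis n => hmul a g).measurable
  measurable_invFun := (by fun_prop : Continuous fun g : Heis n => hmul (hinv a) g).measurable

/-- Right translation as a measurable equivalence. -/
def hmulRightEquiv (a : Heis n) : Heis n ≃ᵐ Heis n where
  toFun g := hmul g a
  invFun g := hmul g (hinv a)
  left_inv g := hmul_hmul_hinv_cancel g a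
  right_inv g := hmul_hinv_hmul_cancel g a
  measurable_toFun := (by fun_prop : Continuous fun g : Heis n => hmul g a).measurable
  measurable_invFun := (by fun_prop : Continuous fun g : Heis n => hmul g (hinv a)).measurable

/-- Central translation as a measurable equivalence. -/
def tshEquiv (s : ℝ) : Heis n ≃ᵐ Heis n where
  toFun := tsh s
  invFun := tsh (-s)
  left_inv g := by rw [tsh_tsh, neg_add_cancel, tsh_zero]
  right_inv g := by rw [tsh_tsh, add_neg_cancel, tsh_zero]
  measurable_toFun := (by fun_prop : Continuous fun g : Heis n => tsh s g).measurable
  measurable_invFun := (by fun_prop : Continuous fun g : Heis n => tsh (-s) g).measurable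

lemma integral_hmul_left (a : Heis n) (f : Heis n → ℝ) : ∫ g, f (hmul a g) = ∫ g, f g :=
  (measurePreserving_hmul_left a).integral_comp (hmulLeftEquiv a).measurableEmbedding f

lemma integral_hmul_right (a : Heis n) (f : Heis n → ℝ) : ∫ g, f (hmul g a) = ∫ g, f g :=
  (measurePreserving_hmul_right a).integral_comp (hmulRightEquiv a).measurableEmbedding f

lemma integral_hinv (f : Heis n → ℝ) : ∫ g, f (hinv g) = ∫ g, f g :=
  measurePreserving_hinv.integral_comp (MeasurableEquiv.neg (Heis n)).measurableEmbedding f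

lemma integral_tsh (s : ℝ) (f : Heis n → ℝ) : ∫ g, f (tsh s g) = ∫ g, f g :=
  (measurePreserving_tsh s).integral_comp (tshEquiv s).measurableEmbedding f

lemma map_hdil {r : ℝ} (hr : 0 < r) :
    (volume : Measure (Heis n)).map (hdil r) =
      ENNReal.ofReal ((r ^ (2 * n + 2))⁻¹) • volume := by
  let L : Heis n →ₗ[ℝ] Heis n := LinearMap.prodMap (r • LinearMap.id)
    (LinearMap.prodMap (r • LinearMap.id) ((r ^ 2) • LinearMap.id))
  have hd : LinearMap.det L = r ^ (2 * n + 2) := by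
    simp only [L, LinearMap.det_prodMap, LinearMap.det_smul, LinearMap.det_id, Module.finrank_pi,
      Fintype.card_fin, Module.finrank_self, mul_one]
    ring
  have hL : (hdil r : Heis n → Heis n) = L := by
    funext g
    simp [L, hdil]
  rw [hL, Measure.map_linearMap_addHaar_eq_smul_addHaar _ (by rw [hd]; positivity), hd,
    abs_of_nonneg (by positivity)]

lemma integral_hdilNorm {r : ℝ} (hr : 0 < r) {f : Heis n → ℝ} (hf : Continuous f) :
    ∫ g, hdilNorm r f g = ∫ g, f g := by
  have h := integral_map (μ := (volume : Measure (Heis n))) (φ := hdil r) (f := f)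
    (Continuous.aemeasurable (by fun_prop)) hf.aestronglyMeasurable
  rw [map_hdil hr, integral_smul_measure, ENNReal.toReal_ofReal (by positivity)] at h
  simp only [hdilNorm]
  rw [integral_const_mul, ← h, smul_eq_mul, mul_inv_cancel_left₀ (by positivity)]

/-! ### Iterated partial derivatives of smooth families and of bump functions -/

lemma contDiff_pop_family {E : Type*} [NormedAddCommGroup E] [NormedSpace ℝ E]
    (i : Fin (2 * n + 1)) {F : E × Heis n → ℝ} (hF : ContDiff ℝ (⊤ : ℕ∞) F) :
    ContDiff ℝ (⊤ : ℕ∞) fun p : E × Heis n => pop i (fun v => F (p.1, v)) p.2 := by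
  have h : (fun p : E × Heis n => pop i (fun v => F (p.1, v)) p.2) =
      fun p => fderiv ℝ F p (0, evec i) := by
    funext p
    have h1 : HasFDerivAt F (fderiv ℝ F p) (p.1, p.2) :=
      (hF.differentiable (by simp) p).hasFDerivAt
    have h2 := h1.comp p.2 (hasFDerivAt_prodMk_right p.1 p.2)
    unfold pop
    change fderiv ℝ (F ∘ fun v => (p.1, v)) p.2 (evec i) = _
    rw [h2.fderiv]
    simp
  rw [h]
  exact (hF.fderiv_right (m := (⊤ : ℕ∞)) (by simp)).clm_apply contDiff_const

lemma contDiff_pop_iterate_family {E : Type*} [NormedAddCommGroup E] [NormedSpace ℝ E]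
    (i : Fin (2 * n + 1)) (m : ℕ) {F : E × Heis n → ℝ} (hF : ContDiff ℝ (⊤ : ℕ∞) F) :
    ContDiff ℝ (⊤ : ℕ∞) fun p : E × Heis n => (pop i)^[m] (fun v => F (p.1, v)) p.2 := by
  induction m with
  | zero => exact hF
  | succ m ih =>
    simp only [Function.iterate_succ_apply']
    exact contDiff_pop_family i ih

lemma contDiff_piter_family {E : Type*} [NormedAddCommGroup E] [NormedSpace ℝ E]
    (I : Fin (2 * n + 1) → ℕ) {F : E × Heis n → ℝ} (hF : ContDiff ℝ (⊤ : ℕ∞) F) :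
    ContDiff ℝ (⊤ : ℕ∞) fun p : E × Heis n => piter I (fun v => F (p.1, v)) p.2 := by
  unfold piter
  induction List.finRange (2 * n + 1) with
  | nil => exact hF
  | cons i l ih => exact contDiff_pop_iterate_family i (I i) ih

lemma piter_induction (I : Fin (2 * n + 1) → ℕ) {P : (Heis n → ℝ) → Prop}
    (hP : ∀ i f, P f → P (pop i f)) {f : Heis n → ℝ} (hf : P f) : P (piter I f) := by
  unfold piter
  induction List.finRange (2 * n + 1) with
  | nil => exact hf
  | cons i l ih =>
    rw [List.foldr_cons]
    induction I i with
    | zero => exact ih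
    | succ m ihm => rw [Function.iterate_succ_apply']; exact hP _ _ ihm

lemma piter_const_mul (I : Fin (2 * n + 1) → ℕ) (c : ℝ) (f : Heis n → ℝ) :
    piter I (fun v => c * f v) = fun v => c * piter I f v := by
  have hpop : ∀ (i : Fin (2 * n + 1)) (f : Heis n → ℝ),
      pop i (fun v => c * f v) = fun v => c * pop i f v := by
    intro i f
    funext v
    unfold pop
    change fderiv ℝ (c • f) v (evec i) = _
    rw [fderiv_const_smul_field]
    rfl
  unfold piter
  induction List.finRange (2 * n + 1) with
  | nil => rfl
  | cons i l ih =>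
    rw [List.foldr_cons, ih, List.foldr_cons]
    induction I i with
    | zero => rfl
    | succ m ihm => rw [Function.iterate_succ_apply', ihm, hpop, Function.iterate_succ_apply']

lemma piter_eq_zero_of_notMem (I : Fin (2 * n + 1) → ℕ) {f : Heis n → ℝ} {s : Set (Heis n)}
    (hs : IsClosed s) (hf : Function.support f ⊆ s) {v : Heis n} (hv : v ∉ s) :
    piter I f v = 0 := by
  have : Function.support (piter I f) ⊆ s := by
    refine piter_induction I (P := fun f => Function.support f ⊆ s) (fun i f hf x hx => ?_) hf
    refine closure_minimal hf hs (support_fderiv_subset ℝ (f := f) fun h0 => hx ?_)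
    simp only [pop, h0, zero_apply]
  by_contra h
  exact hv (this h)

lemma piter_zero_fun (I : Fin (2 * n + 1) → ℕ) (v : Heis n) :
    piter I (fun _ => (0 : ℝ)) v = 0 :=
  piter_eq_zero_of_notMem I (s := ∅) isClosed_empty (by simp) (by simp)

lemma fderiv_neg_arg (f : Heis n → ℝ) (v w : Heis n) :
    fderiv ℝ (fun v => f (-v)) v w = -fderiv ℝ f (-v) w := by
  have := (ContinuousLinearEquiv.neg ℝ (M := Heis n)).comp_right_fderiv (f := f) (x := v)
  have h2 := congrArg (fun L => L w) this
  simpa [Function.comp_def] using h2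

lemma hnorm_le_hnorm_hmul_hinv_add (x v : Heis n) :
    hnorm v ≤ hnorm (hmul x (hinv v)) + hnorm x := by
  have := hnorm_hmul_le (hinv (hmul x (hinv v))) x
  rwa [hnorm_hinv, hinv_hmul, hinv_hinv, hmul_hinv_hmul_cancel] at this

lemma isBump_comp_neg {N : ℕ} {φ : Heis n → ℝ} (h : IsBump n N φ) :
    IsBump n N fun v => φ (-v) := by
  obtain ⟨h1, h2, h3⟩ := h
  refine ⟨h1.comp contDiff_neg, fun v hv => ?_, fun I hI g => ?_⟩
  · have := h2 hv
    rwa [Set.mem_ofPred_eq, hnorm_neg] at this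
  have hpop : ∀ (i : Fin (2 * n + 1)) (c : ℝ) (f : Heis n → ℝ),
      pop i (fun v => c * f (-v)) = fun v => (-c) * pop i f (-v) := by
    intro i c f
    funext v
    unfold pop
    change fderiv ℝ (c • fun v => f (-v)) v (evec i) = _
    rw [fderiv_const_smul_field]
    simp [fderiv_neg_arg]
  have key : ∃ σ : ℝ, |σ| = 1 ∧ piter I (fun v => φ (-v)) = fun v => σ * piter I φ (-v) := by
    clear h3 hI
    unfold piter
    induction List.finRange (2 * n + 1) with
    | nil => exact ⟨1, by simp, by simp⟩
    | cons i l ih =>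
      obtain ⟨σ, hσ, ih⟩ := ih
      rw [List.foldr_cons, ih, List.foldr_cons]
      induction I i with
      | zero => exact ⟨σ, hσ, rfl⟩
      | succ m ihm =>
        obtain ⟨σ', hσ', ihm⟩ := ihm
        exact ⟨-σ', by rwa [abs_neg], by
          rw [Function.iterate_succ_apply', ihm, hpop, Function.iterate_succ_apply']⟩
  obtain ⟨σ, hσ, hk⟩ := key
  rw [hk, abs_mul, hσ, one_mul]
  exact h3 I hI (-g)

lemma hnorm_eq_zero {g : Heis n} (h : hnorm g = 0) : g = 0 := by
  have := norm_le_of_hnorm_le h.le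
  simpa using this

/-- A smooth family vanishing at `h = 0` is, up to a factor comparable to `hnorm h`, a family of
normalized bump functions. -/
lemma exists_isBump_family (N : ℕ) {F : (Heis n × Heis n) × Heis n → ℝ}
    (hF : ContDiff ℝ (⊤ : ℕ∞) F) (hF0 : ∀ g v, F ((g, 0), v) = 0) (R : ℝ) :
    ∃ C : ℝ, 0 < C ∧ ∀ g h : Heis n, hnorm g ≤ R → hnorm h ≤ 1 →
      (Function.support (fun v => F ((g, h), v)) ⊆ {v | hnorm v ≤ 1}) →
      IsBump n N fun v => (C * hnorm h)⁻¹ * F ((g, h), v) := by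
  have hI : ∀ I : Fin (2 * n + 1) → ℕ, ∃ C : ℝ, 0 < C ∧ ∀ g h v : Heis n,
      hnorm g ≤ R → hnorm h ≤ 1 → hnorm v ≤ 1 →
      |piter I (fun v => F ((g, h), v)) v| ≤ C * hnorm h := by
    intro I
    set Q : (Heis n × Heis n) × Heis n → ℝ :=
      fun p => piter I (fun v => F (p.1, v)) p.2 with hQ
    have hQs : ContDiff ℝ (⊤ : ℕ∞) Q := contDiff_piter_family I hF
    set B := max (max R (R ^ 2)) 1
    obtain ⟨C, hC⟩ := (isCompact_closedBall (0 : (Heis n × Heis n) × Heis n) B).exists_bound_of_continuousOn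
      (hQs.continuous_fderiv (by simp)).continuousOn
    refine ⟨max C 1, by positivity, fun g h v hg hh hv => ?_⟩
    have nh := norm_le_of_hnorm_le (le_refl (hnorm h))
    have nh' : ‖h‖ ≤ hnorm h := by
      refine nh.trans (max_le le_rfl ?_)
      nlinarith [hnorm_nonneg h]
    have nv : ‖v‖ ≤ 1 := by simpa using norm_le_of_hnorm_le hv
    have ng := norm_le_of_hnorm_le hg
    have hB : ∀ h' : Heis n, ‖h'‖ ≤ 1 →
        ((g, h'), v) ∈ Metric.closedBall (0 : (Heis n × Heis n) × Heis n) B := by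
      intro h' hh'
      rw [mem_closedBall_zero_iff]
      exact norm_prod_le_iff.2 ⟨norm_prod_le_iff.2 ⟨ng.trans (le_max_left _ _),
        hh'.trans (le_max_right _ _)⟩, nv.trans (le_max_right _ _)⟩
    have := Convex.norm_image_sub_le_of_norm_fderiv_le (𝕜 := ℝ)
      (fun x _ => hQs.differentiable (by simp) x) hC (convex_closedBall _ _)
      (hB 0 (by simp)) (hB h (nh'.trans hh))
    have e0 : Q ((g, 0), v) = 0 := by
      simp only [hQ, hF0]
      exact piter_zero_fun I v
    rw [e0, sub_zero, Prod.mk_sub_mk, Prod.mk_sub_mk, sub_self, sub_self, sub_zero] at this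
    have e1 : ‖(((0 : Heis n), h), (0 : Heis n))‖ = ‖h‖ := by simp [Prod.norm_def]
    rw [e1] at this
    exact this.trans (mul_le_mul (le_max_left _ _) nh' (norm_nonneg _) (by positivity))
  choose c hc0 hc using hI
  have hfin : {I : Fin (2 * n + 1) → ℕ | ∑ i, I i ≤ N}.Finite := by
    refine (Set.finite_Iic (fun _ : Fin (2 * n + 1) => N)).subset fun I hI i => ?_
    exact (Finset.single_le_sum (fun i _ => Nat.zero_le (I i)) (Finset.mem_univ i)).trans hI
  obtain ⟨D, hD⟩ := (hfin.image c).bddAbove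
  refine ⟨max D 1, by positivity, fun g h hg hh hs => ⟨?_, ?_, fun I hI v => ?_⟩⟩
  · exact contDiff_const.mul (hF.comp (contDiff_const.prodMk contDiff_id))
  · exact fun v hv => hs (right_ne_zero_of_mul hv)
  rw [piter_const_mul]
  by_cases hv : hnorm v ≤ 1
  · have h1 := hc I g h v hg hh hv
    have h2 : c I ≤ max D 1 := (hD (Set.mem_image_of_mem c hI)).trans (le_max_left _ _)
    have h3 : |piter I (fun v => F ((g, h), v)) v| ≤ max D 1 * hnorm h :=
      h1.trans (mul_le_mul_of_nonneg_right h2 (hnorm_nonneg h))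
    have h4 : 0 ≤ max D 1 * hnorm h := mul_nonneg (by positivity) (hnorm_nonneg h)
    rw [abs_mul, abs_inv, abs_of_nonneg h4]
    exact inv_mul_le_one_of_le₀ h3 h4
  · beta_reduce
    rw [piter_eq_zero_of_notMem I (isClosed_le continuous_hnorm continuous_const) hs hv]
    simp

/-! ### Calderón–Zygmund kernels -/

lemma _root_.IsCZKernel.comp_neg {N : ℕ} {K : Heis n → ℝ} {C₀ : ℝ} (hK : IsCZKernel n N K C₀) :
    IsCZKernel n N (fun v => K (-v)) C₀ := by
  obtain ⟨h1, h2, h3, h4, h5⟩ := hK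
  refine ⟨h1.comp contDiff_neg.contDiffOn fun g hg => neg_ne_zero.2 hg, fun g hg => ?_,
    fun g hg => ?_, fun g hg => ?_, fun φ hφ r hr η hη => ?_⟩
  · simpa only [hnorm_neg] using h2 (-g) (neg_ne_zero.2 hg)
  · have := h3 (-g) (neg_ne_zero.2 hg)
    rw [hnorm_neg] at this
    simpa [zgrad, fderiv_neg_arg] using this
  · have := h4 (-g) (neg_ne_zero.2 hg)
    rw [hnorm_neg] at this
    simpa [tderiv, fderiv_neg_arg] using this
  · have hS : MeasurableSet {g : Heis n | η < hnorm g} :=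
      (isOpen_lt continuous_const continuous_hnorm).measurableSet
    convert h5 _ (isBump_comp_neg hφ) r hr η hη using 2
    rw [← integral_indicator hS, ← integral_indicator hS, ← integral_hinv]
    refine integral_congr_ae (ae_of_all _ fun v => ?_)
    simp only [Set.indicator, Set.mem_ofPred_eq, hnorm_hinv, ← hinv_eq_neg, hinv_hinv, hdil_hinv]

lemma _root_.IsCZKernel.cancel (N : ℕ) {a : Heis n → ℝ} (ha : ContDiff ℝ (⊤ : ℕ∞) a)
    (hs : Function.support a ⊆ {g | hnorm g ≤ 1}) {R : ℝ} (hR : 0 ≤ R) :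
    ∃ C : ℝ, 0 < C ∧ ∀ (K : Heis n → ℝ) (C₀ : ℝ), IsCZKernel n N K C₀ →
      ∀ r η : ℝ, 0 < r → 0 < η → ∀ g h : Heis n, r * hnorm g ≤ R → r * hnorm h ≤ 1 →
      |∫ v in {v : Heis n | η < hnorm v}, K v * (a (hdil r (hmul (hmul g (hinv h)) (hinv v))) -
        a (hdil r (hmul g (hinv v))))| ≤ C * C₀ * (r * hnorm h) := by
  set F : (Heis n × Heis n) × Heis n → ℝ := fun p =>
    a (hmul (hmul p.1.1 (hinv p.1.2)) (hinv (hdil (R + 2) p.2))) -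
      a (hmul p.1.1 (hinv (hdil (R + 2) p.2))) with hFdef
  have hd : ContDiff ℝ (⊤ : ℕ∞) fun p : (Heis n × Heis n) × Heis n => hinv (hdil (R + 2) p.2) :=
    contDiff_hinv.comp ((contDiff_hdil _).comp contDiff_snd)
  have hF : ContDiff ℝ (⊤ : ℕ∞) F := by
    refine (ha.comp (contDiff_hmul.comp ((contDiff_hmul.comp
      (contDiff_fst.fst.prodMk (contDiff_hinv.comp contDiff_fst.snd))).prodMk hd))).sub
      (ha.comp (contDiff_hmul.comp (contDiff_fst.fst.prodMk hd)))
  have hF0 : ∀ g v, F ((g, 0), v) = 0 := fun g v => by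
    simp only [hFdef, hinv_zero, hmul_zero, sub_self]
  obtain ⟨C, hC, hb⟩ := exists_isBump_family N hF hF0 R
  refine ⟨C, hC, fun K C₀ hK r η hr hη g h hg hh => ?_⟩
  have hr' : 0 < r / (R + 2) := by positivity
  have hR2 : 0 < R + 2 := by positivity
  have hsupp : Function.support (fun v => F ((hdil r g, hdil r h), v)) ⊆ {v | hnorm v ≤ 1} := by
    have aux : ∀ x v : Heis n, hnorm x ≤ R + 1 → a (hmul x (hinv (hdil (R + 2) v))) ≠ 0 →
        hnorm v ≤ 1 := by
      intro x v hx hne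
      have h1 : hnorm (hmul x (hinv (hdil (R + 2) v))) ≤ 1 := hs hne
      have h2 := hnorm_le_hnorm_hmul_hinv_add x (hdil (R + 2) v)
      rw [hnorm_hdil hR2.le] at h2
      have h4 : (R + 2) * hnorm v ≤ (R + 2) * 1 := by linarith
      exact le_of_mul_le_mul_left h4 hR2
    intro v hv
    by_contra hv1
    refine hv ?_
    have hg' : hnorm (hdil r g) ≤ R := by rwa [hnorm_hdil hr.le]
    have hgh' : hnorm (hmul (hdil r g) (hinv (hdil r h))) ≤ R + 1 := by
      refine (hnorm_hmul_le _ _).trans (add_le_add hg' ?_)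
      rwa [hnorm_hinv, hnorm_hdil hr.le]
    simp only [hFdef]
    rw [not_imp_comm.1 (aux _ v hgh') hv1, not_imp_comm.1 (aux _ v (by linarith)) hv1, sub_zero]
  have hbump := hb (hdil r g) (hdil r h) (by rwa [hnorm_hdil hr.le]) (by rwa [hnorm_hdil hr.le])
    hsupp
  have key := hK.2.2.2.2 _ hbump (r / (R + 2)) hr' η hη
  have e : ∀ v : Heis n, F ((hdil r g, hdil r h), hdil (r / (R + 2)) v) =
      a (hdil r (hmul (hmul g (hinv h)) (hinv v))) - a (hdil r (hmul g (hinv v))) := by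
    intro v
    simp only [hFdef, hdil_hdil, mul_div_cancel₀ r hR2.ne', hdil_hmul, hdil_hinv]
  simp only [e, mul_left_comm (K _)] at key
  rw [integral_const_mul, abs_mul, hnorm_hdil hr.le] at key
  rcases (mul_nonneg hr.le (hnorm_nonneg h)).eq_or_lt with h0 | h0
  · have hh0 : h = 0 := hnorm_eq_zero (by
      rcases mul_eq_zero.1 h0.symm with h1 | h1
      · exact absurd h1 hr.ne'
      · exact h1)
    simp [hh0, hinv_zero, hmul_zero, hnorm_zero]
  · have hpos : 0 < C * (r * hnorm h) := by positivity
    rw [abs_inv, abs_of_pos hpos, inv_mul_le_iff₀ hpos] at key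
    linarith

/-! ### Truncated kernels and their smoothing at a single scale -/

lemma abs_fderiv_le (f : Heis n → ℝ) (g d : Heis n) :
    |fderiv ℝ f g d| ≤ zgrad f g * znorm d + |tderiv f g| * |d.2.2| := by
  set L := fderiv ℝ f g with hL
  have e1 : ∀ u : Fin n → ℝ, L (u, 0, 0) = ∑ i, L (Pi.single i 1, 0, 0) * u i := by
    intro u
    have := LinearMap.pi_apply_eq_sum_univ
      (L.toLinearMap ∘ₗ LinearMap.inl ℝ (Fin n → ℝ) ((Fin n → ℝ) × ℝ)) u
    simp only [LinearMap.comp_apply, LinearMap.inl_apply, smul_eq_mul] at this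
    refine this.trans (Finset.sum_congr rfl fun i _ => ?_)
    have : (fun j => if i = j then (1 : ℝ) else 0) = Pi.single i 1 := by
      funext j
      simp [Pi.single_apply, eq_comm]
    rw [mul_comm, this]
    rfl
  have e2 : ∀ u : Fin n → ℝ, L (0, u, 0) = ∑ i, L (0, Pi.single i 1, 0) * u i := by
    intro u
    have := LinearMap.pi_apply_eq_sum_univ
      (L.toLinearMap ∘ₗ LinearMap.inr ℝ (Fin n → ℝ) ((Fin n → ℝ) × ℝ) ∘ₗ
        LinearMap.inl ℝ (Fin n → ℝ) ℝ) u
    simp only [LinearMap.comp_apply, LinearMap.inl_apply, LinearMap.inr_apply, smul_eq_mul] at this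
    refine this.trans (Finset.sum_congr rfl fun i _ => ?_)
    have : (fun j => if i = j then (1 : ℝ) else 0) = Pi.single i 1 := by
      funext j
      simp [Pi.single_apply, eq_comm]
    rw [mul_comm, this]
    rfl
  have ed : d = (d.1, 0, 0) + (0, d.2.1, 0) + d.2.2 • ((0, 0, 1) : Heis n) := by
    refine Prod.ext ?_ (Prod.ext ?_ ?_) <;> simp
  have e3 : L d = (∑ i, L (Pi.single i 1, 0, 0) * d.1 i + ∑ i, L (0, Pi.single i 1, 0) * d.2.1 i)
      + tderiv f g * d.2.2 := by
    conv_lhs => rw [ed]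
    rw [map_add, map_add, map_smul, e1, e2, smul_eq_mul, tderiv, ← hL, mul_comm d.2.2]
  rw [e3]
  refine (abs_add_le _ _).trans (add_le_add ?_ (abs_mul _ _).le)
  exact abs_sum_add_sum_le _ _ _ _

lemma _root_.IsCZKernel.abs_sub_le {N : ℕ} {K : Heis n → ℝ} {C₀ : ℝ} (hC₀ : 0 < C₀)
    (hK : IsCZKernel n N K C₀) {x h : Heis n} (hx : 0 < hnorm x) (hh : hnorm h ≤ hnorm x / 2) :
    |K (hmul x (hinv h)) - K x| ≤
      6 * 2 ^ (2 * n + 3) * C₀ * hnorm h / hnorm x ^ (2 * n + 3) := by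
  obtain ⟨h1, h2, h3, h4, -⟩ := hK
  set d : Heis n := (-h.1, -h.2.1,
    -h.2.2 + 2 * (∑ i, x.2.1 i * (hinv h).1 i) - 2 * ∑ i, x.1 i * (hinv h).2.1 i) with hd
  have hpath : ∀ s : ℝ, x + s • d = hmul x (s • hinv h) := by
    intro s
    refine Prod.ext rfl (Prod.ext rfl ?_)
    simp only [hmul, hd, hinv, Prod.snd_add, Prod.smul_snd, Prod.smul_fst,
      Pi.smul_apply, smul_eq_mul, mul_left_comm _ s, ← Finset.mul_sum]
    ring
  have hnn := hnorm_nonneg h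
  have hsm : ∀ s : ℝ, 0 ≤ s → s ≤ 1 → hnorm (s • hinv h) ≤ hnorm h := by
    intro s hs0 hs1
    have ez : znorm (s • hinv h) = s * znorm h := by
      simp only [znorm, hinv, Prod.smul_fst, Prod.smul_snd, Pi.smul_apply, Pi.neg_apply,
        smul_eq_mul, mul_pow, neg_sq, ← Finset.mul_sum, ← mul_add]
      rw [Real.sqrt_mul (by positivity), Real.sqrt_sq hs0]
    refine hnorm_le_of _ hnn ?_ ?_
    · rw [ez]
      exact (mul_le_of_le_one_left (znorm_nonneg h) hs1).trans (znorm_le_hnorm h)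
    · simp only [hinv, Prod.smul_snd, smul_eq_mul, abs_mul, abs_neg, abs_of_nonneg hs0]
      exact (mul_le_of_le_one_left (abs_nonneg _) hs1).trans (abs_le_hnorm_sq h)
  have hlow : ∀ s : ℝ, 0 ≤ s → s ≤ 1 → hnorm x / 2 ≤ hnorm (x + s • d) := by
    intro s hs0 hs1
    have := hnorm_hmul_le (x + s • d) (hinv (s • hinv h))
    rw [hpath, hmul_hmul_hinv_cancel, hnorm_hinv, ← hpath] at this
    linarith [hsm s hs0 hs1]
  have hdz : znorm d ≤ hnorm h := by
    have : znorm d = znorm h := by simp [znorm, hd]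
    exact this.le.trans (znorm_le_hnorm h)
  have hdt : |d.2.2| ≤ 5 / 2 * (hnorm x * hnorm h) := by
    have b1 := abs_le_hnorm_sq h
    have b2 := (abs_symp_le x (hinv h)).trans (mul_le_mul (znorm_le_hnorm x)
      (znorm_le_hnorm (hinv h)) (znorm_nonneg _) hx.le)
    rw [hnorm_hinv] at b2
    have b3 : hnorm h ^ 2 ≤ hnorm x / 2 * hnorm h := by rw [sq]; gcongr
    simp only [hd]
    rw [abs_le] at *
    constructor <;> linarith
  have key := norm_image_sub_le_of_norm_deriv_le_segment_01' (f := fun s : ℝ => K (x + s • d))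
    (f' := fun s => fderiv ℝ K (x + s • d) d)
    (C := 6 * 2 ^ (2 * n + 3) * C₀ * hnorm h / hnorm x ^ (2 * n + 3)) ?_ ?_
  · have hp1 : x + d = hmul x (hinv h) := by simpa using hpath 1
    simp only [zero_smul, add_zero, one_smul, hp1] at key
    exact key
  · intro s hs
    have hne : x + s • d ≠ 0 := ne_zero_of_hnorm_pos ((half_pos hx).trans_le (hlow s hs.1 hs.2))
    have hdiff : DifferentiableAt ℝ K (x + s • d) :=
      (h1.differentiableOn (by simp)).differentiableAt (isOpen_ne.mem_nhds hne)
    have hline : HasDerivAt (fun s : ℝ => x + s • d) d s := by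
      simpa using ((hasDerivAt_id s).smul_const d).const_add x
    exact (hdiff.hasFDerivAt.comp_hasDerivAt s hline).hasDerivWithinAt
  · intro s hs
    have hl := hlow s hs.1 hs.2.le
    have hl0 : 0 < hnorm x / 2 := half_pos hx
    have hne : x + s • d ≠ 0 := ne_zero_of_hnorm_pos (hl0.trans_le hl)
    refine (abs_fderiv_le K _ d).trans ?_
    have c1 : zgrad K (x + s • d) ≤ C₀ / (hnorm x / 2) ^ (2 * n + 3) :=
      (h3 _ hne).trans (by gcongr)
    have c2 : |tderiv K (x + s • d)| ≤ C₀ / (hnorm x / 2) ^ (2 * n + 4) :=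
      (h4 _ hne).trans (by gcongr)
    calc _ ≤ C₀ / (hnorm x / 2) ^ (2 * n + 3) * hnorm h +
          C₀ / (hnorm x / 2) ^ (2 * n + 4) * (5 / 2 * (hnorm x * hnorm h)) := by
          gcongr
          exact znorm_nonneg d
      _ = _ := by
          have hx' := hx.ne'
          simp only [div_pow]
          field_simp
          ring

/-- The kernel `K` truncated to `{ρ > η}`. -/
noncomputable def kap (η : ℝ) (K : Heis n → ℝ) : Heis n → ℝ :=
  Set.indicator {v : Heis n | η < hnorm v} K

lemma measurableSet_lt_hnorm (η : ℝ) : MeasurableSet {v : Heis n | η < hnorm v} :=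
  (isOpen_lt continuous_const continuous_hnorm).measurableSet

lemma setIntegral_eq_kap (η : ℝ) (K φ : Heis n → ℝ) :
    ∫ v in {v : Heis n | η < hnorm v}, K v * φ v = ∫ v, kap η K v * φ v := by
  rw [← integral_indicator (measurableSet_lt_hnorm η)]
  refine integral_congr_ae (ae_of_all _ fun v => ?_)
  simp only [kap, Set.indicator_mul_left]

lemma _root_.IsCZKernel.measurable_kap {N : ℕ} {K : Heis n → ℝ} {C₀ η : ℝ} (hη : 0 < η)
    (hK : IsCZKernel n N K C₀) : Measurable (kap η K) := by
  classical
  unfold kap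
  rw [← Set.piecewise_eq_indicator]
  refine ContinuousOn.measurable_piecewise (hK.1.continuousOn.mono fun v hv => ?_)
    continuousOn_const (measurableSet_lt_hnorm η)
  exact ne_zero_of_hnorm_pos (hη.trans hv)

lemma _root_.IsCZKernel.abs_kap_le {N : ℕ} {K : Heis n → ℝ} {C₀ η : ℝ} (hC₀ : 0 < C₀) (hη : 0 < η)
    (hK : IsCZKernel n N K C₀) (v : Heis n) : |kap η K v| ≤ C₀ / η ^ (2 * n + 2) := by
  unfold kap
  by_cases hv : η < hnorm v
  · rw [Set.indicator_of_mem (by exact hv)]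
    exact (hK.2.1 v (ne_zero_of_hnorm_pos (hη.trans hv))).trans (by gcongr)
  · rw [Set.indicator_of_notMem (by exact hv), abs_zero]
    positivity

/-- The convolution `a ∗ κ`. -/
noncomputable def conv (κ a : Heis n → ℝ) (x : Heis n) : ℝ := ∫ v, κ v * a (hmul x (hinv v))

lemma conv_eq (κ a : Heis n → ℝ) (x : Heis n) :
    conv κ a x = ∫ w, a w * κ (hmul (hinv w) x) := by
  unfold conv
  rw [← integral_hmul_right x, ← integral_hinv]
  refine integral_congr_ae (ae_of_all _ fun w => ?_)
  simp only [hinv_hmul, hmul_hinv_cancel, hinv_hinv, mul_comm (a _)]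

lemma measurePreserving_hmul_hinv (x : Heis n) :
    MeasurePreserving fun v : Heis n => hmul x (hinv v) :=
  (measurePreserving_hmul_left x).comp measurePreserving_hinv

lemma integrable_conv {κ a : Heis n → ℝ} {M : ℝ} (hκ : Measurable κ) (hM : ∀ v, |κ v| ≤ M)
    (ha : Integrable a) (x : Heis n) : Integrable fun v => κ v * a (hmul x (hinv v)) :=
  ((measurePreserving_hmul_hinv x).integrable_comp_of_integrable ha).bdd_mul
    hκ.aestronglyMeasurable (ae_of_all _ hM)

lemma integrable_conv' {κ a : Heis n → ℝ} {M : ℝ} (hκ : Measurable κ) (hM : ∀ v, |κ v| ≤ M)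
    (ha : Integrable a) (x : Heis n) : Integrable fun w => a w * κ (hmul (hinv w) x) := by
  simp only [mul_comm (a _)]
  refine ha.bdd_mul (c := M) ?_ (ae_of_all _ fun w => hM _)
  refine (hκ.comp ?_).aestronglyMeasurable
  exact Continuous.measurable (by fun_prop)

lemma abs_conv_sub_le_far {N : ℕ} {K : Heis n → ℝ} {C₀ : ℝ} (hC₀ : 0 < C₀)
    (hK : IsCZKernel n N K C₀) {a : Heis n → ℝ} (ha : Integrable a) {r η : ℝ} (hr : 0 < r)
    (hs : ∀ w, a w ≠ 0 → r * hnorm w ≤ 1) (hη : 0 < η) (hη' : r * η ≤ 1) {g h : Heis n}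
    (hg : 4 ≤ r * hnorm g) (hh : r * hnorm h ≤ 1) :
    |conv (kap η K) a (hmul g (hinv h)) - conv (kap η K) a g| ≤
      6 * 2 ^ (4 * n + 6) * C₀ * hnorm h / hnorm g ^ (2 * n + 3) * ∫ w, |a w| := by
  have hκ := hK.measurable_kap hη
  have hM := hK.abs_kap_le hC₀ hη
  have hg0 : 0 < hnorm g := by
    by_contra hc
    nlinarith [hnorm_nonneg g]
  rw [conv_eq, conv_eq, ← integral_sub (integrable_conv' hκ hM ha _) (integrable_conv' hκ hM ha _),
    ← integral_const_mul]
  refine norm_integral_le_of_norm_le (G := ℝ) (ha.abs.const_mul _) (ae_of_all _ fun w => ?_)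
  by_cases hw : a w = 0
  · simp [hw]
  have hw1 := hs w hw
  have hy : hnorm g ≤ hnorm w + hnorm (hmul (hinv w) g) := by
    simpa only [hmul_hinv_cancel] using hnorm_hmul_le w (hmul (hinv w) g)
  set y := hmul (hinv w) g with hydef
  have hy2 : hnorm y ≤ hnorm (hmul y (hinv h)) + hnorm h := by
    simpa only [hmul_hinv_hmul_cancel] using hnorm_hmul_le (hmul y (hinv h)) h
  have hry : 3 ≤ r * hnorm y := by nlinarith
  have hhy : hnorm h ≤ hnorm y / 2 := by
    refine le_of_mul_le_mul_left ?_ hr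
    linarith
  have m1 : η < hnorm y := by
    refine lt_of_mul_lt_mul_left ?_ hr.le
    linarith
  have m2 : η < hnorm (hmul y (hinv h)) := by
    refine lt_of_mul_lt_mul_left ?_ hr.le
    nlinarith
  have hgy : hnorm g / 2 ≤ hnorm y := by
    refine le_of_mul_le_mul_left ?_ hr
    nlinarith
  rw [← hmul_assoc, ← hydef]
  have k1 : kap η K (hmul y (hinv h)) = K (hmul y (hinv h)) := Set.indicator_of_mem (by exact m2) _
  have k2 : kap η K y = K y := Set.indicator_of_mem (by exact m1) _
  rw [k1, k2, ← mul_sub, Real.norm_eq_abs, abs_mul, mul_comm]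
  refine mul_le_mul_of_nonneg_right ?_ (abs_nonneg _)
  have hnn := hnorm_nonneg h
  calc _ ≤ 6 * 2 ^ (2 * n + 3) * C₀ * hnorm h / hnorm y ^ (2 * n + 3) :=
        hK.abs_sub_le hC₀ (hη.trans m1) hhy
    _ ≤ 6 * 2 ^ (2 * n + 3) * C₀ * hnorm h / (hnorm g / 2) ^ (2 * n + 3) := by gcongr
    _ = _ := by
        have := hg0.ne'
        rw [div_pow]
        field_simp
        ring

lemma continuous_hdilNorm {r : ℝ} {a : Heis n → ℝ} (ha : Continuous a) :
    Continuous (hdilNorm r a) := by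
  unfold hdilNorm
  exact continuous_const.mul (ha.comp (by fun_prop))

lemma hdilNorm_ne_zero {r : ℝ} (hr : 0 < r) {a : Heis n → ℝ}
    (hs : Function.support a ⊆ {g | hnorm g ≤ 1}) {w : Heis n} (hw : hdilNorm r a w ≠ 0) :
    r * hnorm w ≤ 1 := by
  have : hnorm (hdil r w) ≤ 1 := hs (right_ne_zero_of_mul hw)
  rwa [hnorm_hdil hr.le] at this

lemma integrable_hdilNorm {r : ℝ} (hr : 0 < r) {a : Heis n → ℝ} (ha : Continuous a)
    (hs : Function.support a ⊆ {g | hnorm g ≤ 1}) : Integrable (hdilNorm r a) := by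
  refine (continuous_hdilNorm ha).integrable_of_hasCompactSupport ?_
  refine HasCompactSupport.intro (isCompact_hnorm_le (1 / r)) fun w hw => ?_
  by_contra hne
  refine hw ?_
  rw [Set.mem_ofPred_eq, le_div_iff₀ hr, mul_comm]
  exact hdilNorm_ne_zero hr hs hne

lemma integral_abs_hdilNorm {r : ℝ} (hr : 0 < r) {a : Heis n → ℝ} (ha : Continuous a) :
    ∫ w, |hdilNorm r a w| = ∫ w, |a w| := by
  rw [← integral_hdilNorm hr ha.abs]
  refine integral_congr_ae (ae_of_all _ fun w => ?_)
  simp only [hdilNorm, abs_mul, abs_of_pos (pow_pos hr _)]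

lemma _root_.IsCZKernel.abs_conv_sub_le (N : ℕ) {a : Heis n → ℝ} (ha : ContDiff ℝ (⊤ : ℕ∞) a)
    (hs : Function.support a ⊆ {g | hnorm g ≤ 1}) :
    ∃ C : ℝ, 0 < C ∧ ∀ (K : Heis n → ℝ) (C₀ : ℝ), 0 < C₀ → IsCZKernel n N K C₀ →
      ∀ r η : ℝ, 0 < r → 0 < η → r * η ≤ 1 → ∀ g h : Heis n, r * hnorm h ≤ 1 →
      |conv (kap η K) (hdilNorm r a) (hmul g (hinv h)) - conv (kap η K) (hdilNorm r a) g| ≤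
        C * C₀ * r ^ (2 * n + 2) * (r * hnorm h) / (1 + r * hnorm g) ^ (2 * n + 3) := by
  obtain ⟨C, hC, hnear⟩ := IsCZKernel.cancel N ha hs (R := 4) (by norm_num)
  set D := ∫ w, |a w| with hD
  have hD0 : 0 ≤ D := integral_nonneg fun w => abs_nonneg _
  refine ⟨C * 5 ^ (2 * n + 3) + 6 * 2 ^ (4 * n + 6) * 2 ^ (2 * n + 3) * D, by positivity,
    fun K C₀ hC₀ hK r η hr hη hη' g h hh => ?_⟩
  have hrh : 0 ≤ r * hnorm h := mul_nonneg hr.le (hnorm_nonneg h)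
  have hrg : 0 ≤ r * hnorm g := mul_nonneg hr.le (hnorm_nonneg g)
  have hai := integrable_hdilNorm hr ha.continuous hs
  rcases le_or_gt (r * hnorm g) 4 with hg | hg
  · have h1 := hnear K C₀ hK r η hr hη g h hg hh
    rw [setIntegral_eq_kap] at h1
    have hκ := hK.measurable_kap hη
    have hM := hK.abs_kap_le hC₀ hη
    have e : conv (kap η K) (hdilNorm r a) (hmul g (hinv h)) - conv (kap η K) (hdilNorm r a) g =
        r ^ (2 * n + 2) * ∫ v, kap η K v * (a (hdil r (hmul (hmul g (hinv h)) (hinv v))) -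
          a (hdil r (hmul g (hinv v)))) := by
      unfold conv
      rw [← integral_sub (integrable_conv hκ hM hai _) (integrable_conv hκ hM hai _),
        ← integral_const_mul]
      refine integral_congr_ae (ae_of_all _ fun v => ?_)
      simp only [hdilNorm]
      ring
    rw [e, abs_mul, abs_of_pos (pow_pos hr _), le_div_iff₀ (by positivity)]
    calc _ ≤ r ^ (2 * n + 2) * (C * C₀ * (r * hnorm h)) * (5 : ℝ) ^ (2 * n + 3) := by
          gcongr
          linarith
      _ = C * 5 ^ (2 * n + 3) * C₀ * r ^ (2 * n + 2) * (r * hnorm h) := by ring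
      _ ≤ _ := by
          gcongr
          exact le_add_of_nonneg_right (by positivity)
  · have h1 := abs_conv_sub_le_far hC₀ hK hai hr (fun w hw => hdilNorm_ne_zero hr hs hw) hη hη'
      hg.le hh
    rw [integral_abs_hdilNorm hr ha.continuous, ← hD] at h1
    have hg0 : 0 < hnorm g := by
      by_contra hc
      nlinarith [hnorm_nonneg g]
    have hnn := hnorm_nonneg h
    refine h1.trans ?_
    rw [le_div_iff₀ (by positivity)]
    calc _ ≤ 6 * 2 ^ (4 * n + 6) * C₀ * hnorm h / hnorm g ^ (2 * n + 3) * D *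
          (2 * (r * hnorm g)) ^ (2 * n + 3) := by
          gcongr
          linarith
      _ = (6 * 2 ^ (4 * n + 6) * 2 ^ (2 * n + 3) * D) * C₀ * r ^ (2 * n + 2) * (r * hnorm h) := by
          have := hg0.ne'
          simp only [mul_pow]
          field_simp
          ring
      _ ≤ _ := by
          gcongr
          exact le_add_of_nonneg_left (by positivity)

lemma measurable_conv {κ a : Heis n → ℝ} (hκ : Measurable κ) (ha : Measurable a) :
    Measurable (conv κ a) := by
  unfold conv
  refine (StronglyMeasurable.integral_prod_right (ν := volume) (E := ℝ) (f := fun (x : Heis n) v =>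
    κ v * a (hmul x (hinv v))) ?_).measurable
  refine Measurable.stronglyMeasurable ?_
  refine (hκ.comp measurable_snd).mul (ha.comp ?_)
  exact Continuous.measurable (by fun_prop)

lemma abs_conv_le {κ a : Heis n → ℝ} {M : ℝ} (hM : ∀ v, |κ v| ≤ M)
    (ha : Integrable a) (x : Heis n) : |conv κ a x| ≤ M * ∫ w, |a w| := by
  rw [conv_eq, ← integral_const_mul]
  refine norm_integral_le_of_norm_le (G := ℝ) (ha.abs.const_mul _) (ae_of_all _ fun w => ?_)
  rw [Real.norm_eq_abs, abs_mul, mul_comm]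
  exact mul_le_mul_of_nonneg_right (hM _) (abs_nonneg _)

/-- The convolution `a ∗ κ ∗ b`. -/
noncomputable def conv₂ (κ a b : Heis n → ℝ) (g : Heis n) : ℝ :=
  ∫ h, b h * conv κ a (hmul g (hinv h))

lemma _root_.IsCZKernel.abs_conv₂_le (N : ℕ) {a b : Heis n → ℝ} (ha : ContDiff ℝ (⊤ : ℕ∞) a)
    (has : Function.support a ⊆ {g | hnorm g ≤ 1}) (hb : Continuous b)
    (hbs : Function.support b ⊆ {g | hnorm g ≤ 1}) (hb0 : ∫ g, b g = 0) :
    ∃ C : ℝ, 0 < C ∧ ∀ (K : Heis n → ℝ) (C₀ : ℝ), 0 < C₀ → IsCZKernel n N K C₀ →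
      ∀ r R η : ℝ, 0 < r → r ≤ R → 0 < η → r * η ≤ 1 → ∀ g : Heis n,
      |conv₂ (kap η K) (hdilNorm r a) (hdilNorm R b) g| ≤
        C * C₀ * (r / R) * (r ^ (2 * n + 2) / (1 + r * hnorm g) ^ (2 * n + 3)) := by
  obtain ⟨C, hC, h⟩ := IsCZKernel.abs_conv_sub_le N ha has
  set D := ∫ w, |b w| with hD
  have hD0 : 0 ≤ D := integral_nonneg fun w => abs_nonneg _
  refine ⟨C * (D + 1), by positivity, fun K C₀ hC₀ hK r R η hr hrR hη hη' g => ?_⟩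
  have hR := hr.trans_le hrR
  have hκ := hK.measurable_kap hη
  have hM := hK.abs_kap_le hC₀ hη
  have hai := integrable_hdilNorm hr ha.continuous has
  have hbi := integrable_hdilNorm hR hb hbs
  set A := conv (kap η K) (hdilNorm r a) with hA
  have hAm : Measurable A := measurable_conv hκ (continuous_hdilNorm ha.continuous).measurable
  have hAi : Integrable fun h => hdilNorm R b h * A (hmul g (hinv h)) := by
    simp only [mul_comm (hdilNorm R b _)]
    refine hbi.bdd_mul (hAm.comp ?_).aestronglyMeasurable (ae_of_all _ fun h => abs_conv_le hM hai _)
    exact Continuous.measurable (by fun_prop)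
  have e : conv₂ (kap η K) (hdilNorm r a) (hdilNorm R b) g =
      ∫ h, hdilNorm R b h * (A (hmul g (hinv h)) - A g) := by
    simp only [mul_sub]
    rw [integral_sub hAi (hbi.mul_const _), integral_mul_const, integral_hdilNorm hR hb, hb0,
      zero_mul, sub_zero, conv₂]
  have hrg : 0 ≤ r * hnorm g := mul_nonneg hr.le (hnorm_nonneg g)
  rw [e]
  set B := C * C₀ * r ^ (2 * n + 2) * (r / R) / (1 + r * hnorm g) ^ (2 * n + 3) with hB
  have hB0 : 0 ≤ B := by positivity
  have h1 : |∫ h, hdilNorm R b h * (A (hmul g (hinv h)) - A g)| ≤ B * D := by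
    rw [hD, ← integral_abs_hdilNorm hR hb, ← integral_const_mul]
    refine norm_integral_le_of_norm_le (G := ℝ) (hbi.abs.const_mul _) (ae_of_all _ fun w => ?_)
    by_cases hw : hdilNorm R b w = 0
    · simp [hw]
    rw [Real.norm_eq_abs, abs_mul, mul_comm]
    refine mul_le_mul_of_nonneg_right ?_ (abs_nonneg _)
    have hRw := hdilNorm_ne_zero hR hbs hw
    have hw0 := hnorm_nonneg w
    have hrw : r * hnorm w ≤ r / R := by
      rw [div_eq_mul_inv]
      refine mul_le_mul_of_nonneg_left ?_ hr.le
      rw [← one_div, le_div_iff₀ hR]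
      linarith
    refine (h K C₀ hC₀ hK r η hr hη hη' g w (hrw.trans ((div_le_one hR).2 hrR))).trans ?_
    rw [hB]
    gcongr
  refine h1.trans ((mul_le_mul_of_nonneg_left (le_add_of_nonneg_right zero_le_one) hB0).trans ?_)
  rw [hB]
  apply le_of_eq
  ring

/-! ### Reduction to a convolution in the central variable -/

lemma integrable_mul_comp_skew {α β : Type*} [MeasurableSpace α] [MeasurableSpace β]
    {μ : Measure α} {ν : Measure β} [SFinite μ] [SFinite ν] {f : α → ℝ} {F : β → ℝ}
    (hf : Integrable f μ) (hF : Integrable F ν) {T : α → β → β}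
    (hT : Measurable (Function.uncurry T)) (hT' : ∀ x, MeasurePreserving (T x) ν ν) :
    Integrable (fun p : α × β => f p.1 * F (T p.1 p.2)) (μ.prod ν) := by
  have := (MeasurePreserving.id μ).skew_product hT (ae_of_all _ fun x => (hT' x).map_eq)
  exact this.integrable_comp_of_integrable (hf.mul_prod hF)

/-- The convolution of `a` with `c` in the central variable. -/
noncomputable def vconv (a : Heis n → ℝ) (c : ℝ → ℝ) (x : Heis n) : ℝ :=
  ∫ u, a (tsh u x) * c u

lemma measurable_vconv {a : Heis n → ℝ} {c : ℝ → ℝ} (ha : Measurable a) (hc : Measurable c) :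
    Measurable (vconv a c) := by
  unfold vconv
  refine (StronglyMeasurable.integral_prod_right (ν := volume) (E := ℝ)
    (f := fun (x : Heis n) (u : ℝ) => a (tsh u x) * c u) ?_).measurable
  refine Measurable.stronglyMeasurable ((ha.comp ?_).mul (hc.comp measurable_snd))
  exact Continuous.measurable (by fun_prop)

lemma integrable_mul_tsh {a : Heis n → ℝ} {c : ℝ → ℝ} (ha : Integrable a) (hc : Integrable c) :
    Integrable fun p : ℝ × Heis n => c p.1 * a (tsh p.1 p.2) :=
  integrable_mul_comp_skew hc ha (T := fun u x => tsh u x)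
    (Continuous.measurable (by unfold Function.uncurry; fun_prop)) measurePreserving_tsh

lemma integrable_vconv {a : Heis n → ℝ} {c : ℝ → ℝ} (ha : Integrable a) (hc : Integrable c) :
    Integrable (vconv a c) := by
  have := (integrable_mul_tsh ha hc).integral_prod_right
  unfold vconv
  simpa only [mul_comm] using this

lemma conv_vconv {κ a : Heis n → ℝ} {c : ℝ → ℝ} {M : ℝ} (hκ : Measurable κ) (hM : ∀ v, |κ v| ≤ M)
    (ha : Integrable a) (hc : Integrable c) (x : Heis n) :
    conv κ (vconv a c) x = ∫ u, c u * conv κ a (tsh u x) := by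
  have hi : Integrable fun p : ℝ × Heis n => κ p.2 * (c p.1 * a (tsh p.1 (hmul x (hinv p.2)))) := by
    refine Integrable.bdd_mul ?_ (hκ.comp measurable_snd).aestronglyMeasurable
      (ae_of_all _ fun p => hM p.2)
    refine integrable_mul_comp_skew hc ha (T := fun u v => tsh u (hmul x (hinv v)))
      (Continuous.measurable (by unfold Function.uncurry; fun_prop)) fun u => ?_
    exact (measurePreserving_tsh u).comp (measurePreserving_hmul_hinv x)
  have := integral_integral_swap
    (f := fun (u : ℝ) (v : Heis n) => κ v * (c u * a (tsh u (hmul x (hinv v))))) hi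
  simp only [conv, vconv, ← integral_const_mul, hmul_tsh_left]
  refine (Eq.trans ?_ this.symm).trans ?_ <;>
  · refine integral_congr_ae (ae_of_all _ fun _ => integral_congr_ae (ae_of_all _ fun _ => ?_))
    ring

lemma integral_mul_hmul_hinv_eq_conv₂ {κ a b : Heis n → ℝ} {M : ℝ} (hκ : Measurable κ)
    (hM : ∀ v, |κ v| ≤ M) (ha : Integrable a) (hb : Integrable b) (g : Heis n) :
    ∫ v, κ v * ∫ w, a w * b (hmul (hinv v) (hmul (hinv w) g)) = conv₂ κ a b g := by
  have hi : Integrable fun p : Heis n × Heis n =>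
      κ p.2 * (b p.1 * a (hmul (hmul g (hinv p.1)) (hinv p.2))) := by
    refine Integrable.bdd_mul ?_ (hκ.comp measurable_snd).aestronglyMeasurable
      (ae_of_all _ fun p => hM p.2)
    exact integrable_mul_comp_skew hb ha (T := fun h v => hmul (hmul g (hinv h)) (hinv v))
      (Continuous.measurable (by unfold Function.uncurry; fun_prop)) fun h =>
        measurePreserving_hmul_hinv _
  have := integral_integral_swap (f := fun (h v : Heis n) =>
    κ v * (b h * a (hmul (hmul g (hinv h)) (hinv v)))) hi
  have e : ∀ v : Heis n, ∫ w, a w * b (hmul (hinv v) (hmul (hinv w) g)) =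
      ∫ h, b h * a (hmul (hmul g (hinv h)) (hinv v)) := by
    intro v
    rw [← integral_hmul_right (hinv v), ← integral_hmul_left g, ← integral_hinv]
    refine integral_congr_ae (ae_of_all _ fun h => ?_)
    have : hmul (hinv v) (hmul (hinv (hmul (hmul g (hinv h)) (hinv v))) g) = h := by
      simp only [hinv_hmul, hinv_hinv, hmul_assoc, hinv_hmul_cancel]
      rw [← hmul_assoc, hmul_hinv_hmul_cancel]
    simp only [this, mul_comm]
  simp only [conv₂, conv, ← integral_const_mul, e]
  rw [← this]
  refine integral_congr_ae (ae_of_all _ fun _ => integral_congr_ae (ae_of_all _ fun _ => ?_))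
  ring

lemma measurable_conv₂ {κ a b : Heis n → ℝ} (hκ : Measurable κ) (ha : Measurable a)
    (hb : Measurable b) : Measurable (conv₂ κ a b) := by
  unfold conv₂
  refine (StronglyMeasurable.integral_prod_right (ν := volume) (E := ℝ)
    (f := fun (g : Heis n) h => b h * conv κ a (hmul g (hinv h))) ?_).measurable
  refine Measurable.stronglyMeasurable ((hb.comp measurable_snd).mul
    ((measurable_conv hκ ha).comp ?_))
  exact Continuous.measurable (by fun_prop)

lemma abs_conv₂_le {κ a b : Heis n → ℝ} {M : ℝ} (hM : ∀ v, |κ v| ≤ M) (ha : Integrable a)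
    (hb : Integrable b) (g : Heis n) :
    |conv₂ κ a b g| ≤ (M * ∫ w, |a w|) * ∫ w, |b w| := by
  unfold conv₂
  rw [← integral_const_mul]
  refine norm_integral_le_of_norm_le (G := ℝ) (hb.abs.const_mul _) (ae_of_all _ fun w => ?_)
  rw [Real.norm_eq_abs, abs_mul, mul_comm]
  exact mul_le_mul_of_nonneg_right (abs_conv_le hM ha _) (abs_nonneg _)

lemma conv₂_vconv_right {κ a b : Heis n → ℝ} {d : ℝ → ℝ} {M : ℝ} (hκ : Measurable κ)
    (hM : ∀ v, |κ v| ≤ M) (ham : Measurable a) (ha : Integrable a) (hb : Integrable b)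
    (hd : Integrable d) (g : Heis n) :
    conv₂ κ a (vconv b d) g = ∫ u, d u * conv₂ κ a b (tsh u g) := by
  have hP := measurable_conv hκ ham
  have hi : Integrable fun p : ℝ × Heis n =>
      conv κ a (hmul g (hinv p.2)) * (d p.1 * b (tsh p.1 p.2)) := by
    refine Integrable.bdd_mul (integrable_mul_tsh hb hd) (hP.comp ?_).aestronglyMeasurable
      (ae_of_all _ fun p => abs_conv_le hM ha _)
    exact Continuous.measurable (by fun_prop)
  have := integral_integral_swap (f := fun (u : ℝ) (h : Heis n) =>
    conv κ a (hmul g (hinv h)) * (d u * b (tsh u h))) hi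
  have e : ∀ u : ℝ, conv₂ κ a b (tsh u g) = ∫ h, b (tsh u h) * conv κ a (hmul g (hinv h)) := by
    intro u
    unfold conv₂
    rw [← integral_tsh u]
    refine integral_congr_ae (ae_of_all _ fun h => ?_)
    simp only [hinv_tsh, hmul_tsh_left, hmul_tsh_right, tsh_tsh, neg_add_cancel, tsh_zero]
  simp only [e, ← integral_const_mul]
  simp only [conv₂, vconv, ← integral_mul_const]
  refine (Eq.trans ?_ this.symm).trans ?_ <;>
  · refine integral_congr_ae (ae_of_all _ fun _ => integral_congr_ae (ae_of_all _ fun _ => ?_))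
    ring

lemma conv₂_vconv_left {κ a b : Heis n → ℝ} {c : ℝ → ℝ} {M : ℝ} (hκ : Measurable κ)
    (hM : ∀ v, |κ v| ≤ M) (ham : Measurable a) (ha : Integrable a) (hb : Integrable b)
    (hc : Integrable c) (g : Heis n) :
    conv₂ κ (vconv a c) b g = ∫ u, c u * conv₂ κ a b (tsh u g) := by
  have hP := measurable_conv hκ ham
  have hi : Integrable fun p : ℝ × Heis n =>
      conv κ a (tsh p.1 (hmul g (hinv p.2))) * (c p.1 * b p.2) := by
    refine Integrable.bdd_mul (hc.mul_prod hb) (hP.comp ?_).aestronglyMeasurable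
      (ae_of_all _ fun p => abs_conv_le hM ha _)
    exact Continuous.measurable (by fun_prop)
  have := integral_integral_swap (f := fun (u : ℝ) (h : Heis n) =>
    conv κ a (tsh u (hmul g (hinv h))) * (c u * b h)) hi
  simp only [conv₂, conv_vconv hκ hM ha hc, ← integral_const_mul, hmul_tsh_left]
  refine (Eq.trans ?_ this.symm).trans ?_ <;>
  · refine integral_congr_ae (ae_of_all _ fun _ => integral_congr_ae (ae_of_all _ fun _ => ?_))
    ring

/-- The convolution `c ∗ d` on the centre. -/
noncomputable def rconv (c d : ℝ → ℝ) (s : ℝ) : ℝ := ∫ u, d u * c (s - u)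

lemma integral_mul_integral_add {c d Q : ℝ → ℝ} {M : ℝ} (hc : Integrable c) (hd : Integrable d)
    (hQ : Measurable Q) (hM : ∀ s, |Q s| ≤ M) :
    ∫ u', d u' * ∫ u, c u * Q (u + u') = ∫ s, rconv c d s * Q s := by
  have hi : Integrable fun p : ℝ × ℝ => Q p.2 * (d p.1 * c (p.2 - p.1)) := by
    refine Integrable.bdd_mul ?_ (hQ.comp measurable_snd).aestronglyMeasurable
      (ae_of_all _ fun p => hM _)
    exact integrable_mul_comp_skew hd hc (T := fun u s => s - u)
      (Continuous.measurable (by unfold Function.uncurry; fun_prop)) fun u =>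
        measurePreserving_sub_right volume u
  have := integral_integral_swap (f := fun u s : ℝ => Q s * (d u * c (s - u))) hi
  have e : ∀ u' : ℝ, ∫ u, c u * Q (u + u') = ∫ s, c (s - u') * Q s := by
    intro u'
    rw [← integral_sub_right_eq_self _ u']
    simp only [sub_add_cancel]
  simp only [e, rconv, ← integral_const_mul, ← integral_mul_const]
  refine Eq.trans ?_ (this.trans ?_) <;>
  · refine integral_congr_ae (ae_of_all _ fun _ => integral_congr_ae (ae_of_all _ fun _ => ?_))
    ring

lemma integral_vconv_mul_vconv {κ a b : Heis n → ℝ} {c d : ℝ → ℝ} {M : ℝ} (hκ : Measurable κ)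
    (hM : ∀ v, |κ v| ≤ M) (ham : Measurable a) (ha : Integrable a) (hbm : Measurable b)
    (hb : Integrable b) (hcm : Measurable c) (hc : Integrable c) (hd : Integrable d) (g : Heis n) :
    ∫ v, κ v * ∫ w, vconv a c w * vconv b d (hmul (hinv v) (hmul (hinv w) g)) =
      ∫ s, rconv c d s * conv₂ κ a b (tsh s g) := by
  rw [integral_mul_hmul_hinv_eq_conv₂ hκ hM (integrable_vconv ha hc) (integrable_vconv hb hd),
    conv₂_vconv_right hκ hM (measurable_vconv ham hcm) (integrable_vconv ha hc) hb hd,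
    ← integral_mul_integral_add (Q := fun s => conv₂ κ a b (tsh s g)) hc hd
      ((measurable_conv₂ hκ ham hbm).comp (Continuous.measurable (by fun_prop)))
      fun s => abs_conv₂_le hM ha hb _]
  simp only [conv₂_vconv_left hκ hM ham ha hb hc, tsh_tsh]

lemma integral_vconv_mul_vconv_neg (K a b : Heis n → ℝ) (c d : ℝ → ℝ) (g : Heis n) (η : ℝ) :
    ∫ v in {v : Heis n | η < hnorm v}, K v *
        ∫ w, vconv a c w * vconv b d (hmul (hinv v) (hmul (hinv w) g)) =
      ∫ v in {v : Heis n | η < hnorm v}, K (-v) *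
        ∫ w, vconv (fun x => b (-x)) (fun u => d (-u)) w *
          vconv (fun x => a (-x)) (fun u => c (-u)) (hmul (hinv v) (hmul (hinv w) (-g))) := by
  have hv : ∀ (a : Heis n → ℝ) (c : ℝ → ℝ) (x : Heis n),
      vconv (fun x => a (-x)) (fun u => c (-u)) x = vconv a c (-x) := by
    intro a c x
    unfold vconv
    rw [← integral_neg_eq_self]
    refine integral_congr_ae (ae_of_all _ fun u => ?_)
    have : -tsh (-u) x = tsh u (-x) := by
      refine Prod.ext rfl (Prod.ext rfl ?_)
      simp [tsh]
      ring
    simp only [this, neg_neg]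
  rw [setIntegral_eq_kap, setIntegral_eq_kap (K := fun v => K (-v)), ← integral_hinv]
  refine integral_congr_ae (ae_of_all _ fun v => ?_)
  have hk : kap η K (hinv v) = kap η (fun v => K (-v)) v := by
    simp only [kap, Set.indicator, Set.mem_ofPred_eq, hnorm_neg, hinv_eq_neg]
  simp only [hk]
  congr 1
  rw [← integral_hmul_right v, ← integral_hmul_left g]
  refine integral_congr_ae (ae_of_all _ fun w => ?_)
  have e1 : hmul (hinv (hinv v)) (hmul (hinv (hmul (hmul g w) v)) g) = hinv w := by
    simp only [hinv_hmul, hinv_hinv, hmul_assoc, hmul_hinv_cancel]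
    rw [← hmul_assoc, hmul_hinv_hmul_cancel]
  have e2 : hinv (hmul (hinv v) (hmul (hinv w) (hinv g))) = hmul (hmul g w) v := by
    simp only [hinv_hmul, hinv_hinv]
  simp only [hv]
  simp only [← hinv_eq_neg, e1, e2, mul_comm]

/-! ### Estimates in the central variable -/

/-- The `L¹`-normalized weight `p / (1 + p|s|)^{5/4}`. -/
noncomputable def wgt (p s : ℝ) : ℝ := p / (1 + p * |s|) ^ (5 / 4 : ℝ)

lemma wgt_nonneg {p : ℝ} (hp : 0 < p) (s : ℝ) : 0 ≤ wgt p s := by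
  unfold wgt
  positivity

lemma wgt_le {p : ℝ} (hp : 0 < p) (s : ℝ) : wgt p s ≤ p := by
  refine div_le_self hp.le (Real.one_le_rpow ?_ (by norm_num))
  exact le_add_of_nonneg_right (by positivity)

lemma continuous_wgt {p : ℝ} (hp : 0 < p) : Continuous (wgt p) := by
  unfold wgt
  refine continuous_const.div (Continuous.rpow_const (by fun_prop) fun s => ?_) fun s => ?_
  · exact Or.inr (by norm_num)
  · positivity

lemma integrable_wgt_one : Integrable (wgt 1) := by
  have := integrable_one_add_norm (E := ℝ) (μ := volume) (r := 5 / 4) (by norm_num)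
  refine this.congr (ae_of_all _ fun s => ?_)
  simp only [wgt, one_mul, Real.norm_eq_abs]
  rw [Real.rpow_neg (by positivity), one_div]

lemma wgt_eq {p : ℝ} (hp : 0 < p) : wgt p = fun s => p * wgt 1 (p * s) :=
  funext fun s => by simp only [wgt, one_mul, abs_mul, abs_of_pos hp, mul_one_div]

lemma integrable_wgt {p : ℝ} (hp : 0 < p) : Integrable (wgt p) := by
  rw [wgt_eq hp]
  exact (integrable_wgt_one.comp_mul_left' hp.ne').const_mul p

lemma integral_wgt {p : ℝ} (hp : 0 < p) : ∫ s, wgt p s = ∫ s, wgt 1 s := by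
  rw [wgt_eq hp, integral_const_mul, Measure.integral_comp_mul_left, abs_of_pos (inv_pos.2 hp),
    smul_eq_mul, mul_inv_cancel_left₀ hp.ne']

lemma wgt_mul_wgt_le {p p' : ℝ} (hp' : 0 < p') (h : p' ≤ p) (t u : ℝ) :
    wgt p u * wgt p' (t - u) ≤
      4 ^ (5 / 4 : ℝ) * wgt p' t * (wgt p u + wgt p' (t - u)) := by
  have hp := hp'.trans_le h
  have n1 := wgt_nonneg hp u
  have n2 := wgt_nonneg hp' (t - u)
  have n3 := wgt_nonneg hp' t
  have n4 : (0 : ℝ) < 4 ^ (5 / 4 : ℝ) := by positivity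
  rcases le_or_gt ((1 + p' * |t|) / 4) (1 + p' * |t - u|) with hc | hc
  · have : wgt p' (t - u) ≤ 4 ^ (5 / 4 : ℝ) * wgt p' t := by
      unfold wgt
      calc _ ≤ p' / ((1 + p' * |t|) / 4) ^ (5 / 4 : ℝ) := by gcongr
        _ = _ := by
          rw [Real.div_rpow (by positivity) (by positivity)]
          field_simp
    calc _ ≤ wgt p u * (4 ^ (5 / 4 : ℝ) * wgt p' t) := by gcongr
      _ = 4 ^ (5 / 4 : ℝ) * wgt p' t * wgt p u := by ring
      _ ≤ _ := by
        gcongr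
        exact le_add_of_nonneg_right n2
  · have hu : (1 + p' * |t|) / 4 ≤ p' * |u| := by
      have : |t| ≤ |t - u| + |u| := by simpa using abs_add_le (t - u) u
      nlinarith [mul_nonneg hp'.le (abs_nonneg t)]
    have : wgt p u ≤ 4 ^ (5 / 4 : ℝ) * wgt p' t := by
      have h1 : p / p' * ((1 + p' * |t|) / 4) ^ (5 / 4 : ℝ) ≤ (1 + p * |u|) ^ (5 / 4 : ℝ) := by
        have hone : 1 ≤ p / p' := (one_le_div hp').2 h
        calc _ ≤ (p / p') ^ (5 / 4 : ℝ) * ((1 + p' * |t|) / 4) ^ (5 / 4 : ℝ) := by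
              gcongr
              exact Real.self_le_rpow_of_one_le hone (by norm_num)
          _ = (p / p' * ((1 + p' * |t|) / 4)) ^ (5 / 4 : ℝ) :=
              (Real.mul_rpow (by positivity) (by positivity)).symm
          _ ≤ _ := by
              refine Real.rpow_le_rpow (by positivity) ?_ (by norm_num)
              calc _ ≤ p / p' * (p' * |u|) := by gcongr
                _ = p * |u| := by field_simp
                _ ≤ _ := by linarith
      unfold wgt
      calc _ ≤ p / (p / p' * ((1 + p' * |t|) / 4) ^ (5 / 4 : ℝ)) := by gcongr
        _ = _ := by
          rw [Real.div_rpow (by positivity) (by positivity)]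
          field_simp
    calc _ ≤ 4 ^ (5 / 4 : ℝ) * wgt p' t * wgt p' (t - u) := by gcongr
      _ ≤ _ := by
        gcongr
        exact le_add_of_nonneg_left n1

lemma integrable_wgt_mul_wgt {p p' : ℝ} (hp : 0 < p) (hp' : 0 < p') (t : ℝ) :
    Integrable fun u => wgt p u * wgt p' (t - u) := by
  refine ((integrable_wgt hp').comp_sub_left t).bdd_mul (c := p)
    (continuous_wgt hp).aestronglyMeasurable (ae_of_all _ fun u => ?_)
  rw [Real.norm_eq_abs, abs_of_nonneg (wgt_nonneg hp u)]
  exact wgt_le hp u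

lemma integral_wgt_mul_wgt_le {p p' : ℝ} (hp : 0 < p) (hp' : 0 < p') (t : ℝ) :
    ∫ u, wgt p u * wgt p' (t - u) ≤
      4 ^ (5 / 4 : ℝ) * (2 * ∫ s, wgt 1 s) * wgt (min p p') t := by
  wlog h : p' ≤ p generalizing p p'
  · have := this hp' hp (le_of_not_ge h)
    rw [min_comm, ← integral_sub_left_eq_self _ _ t] at this
    simpa only [sub_sub_cancel, mul_comm (wgt p' _)] using this
  rw [min_eq_right h]
  have i1 := integrable_wgt hp
  have i2 := (integrable_wgt hp').comp_sub_left t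
  refine (integral_mono (integrable_wgt_mul_wgt hp hp' t) ((i1.add i2).const_mul _)
    fun u => wgt_mul_wgt_le hp' h t u).trans (le_of_eq ?_)
  rw [integral_const_mul]
  simp only [Pi.add_apply]
  rw [integral_add i1 i2, integral_sub_left_eq_self (wgt p') _ t, integral_wgt hp, integral_wgt hp']
  ring

lemma pow_div_le_mul_wgt {r : ℝ} (hr : 0 < r) (g : Heis n) :
    r ^ (2 * n + 2) / (1 + r * hnorm g) ^ (2 * n + 3) ≤
      r ^ (2 * n) / (1 + r * znorm g) ^ (2 * (n : ℝ) + 1 / 2) * wgt (r ^ 2) g.2.2 := by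
  have hz := znorm_nonneg g
  have hg := hnorm_nonneg g
  have e1 : (1 + r * hnorm g) ^ (2 * n + 3) =
      (1 + r * hnorm g) ^ (2 * (n : ℝ) + 1 / 2) * ((1 + r * hnorm g) ^ 2) ^ (5 / 4 : ℝ) := by
    have h0 : 0 < 1 + r * hnorm g := by positivity
    rw [← Real.rpow_natCast _ 2, ← Real.rpow_mul h0.le, ← Real.rpow_add h0, ← Real.rpow_natCast]
    congr 1
    push_cast
    ring
  have e2 : 1 + r ^ 2 * |g.2.2| ≤ (1 + r * hnorm g) ^ 2 := by
    nlinarith [abs_le_hnorm_sq g, mul_nonneg hr.le hg,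
      mul_le_mul_of_nonneg_left (abs_le_hnorm_sq g) (sq_nonneg r)]
  rw [e1, wgt, div_mul_div_comm, ← pow_add]
  have := znorm_le_hnorm g
  gcongr

lemma _root_.IsCZKernel.abs_integral_le (N : ℕ) {a b : Heis n → ℝ} (ha : ContDiff ℝ (⊤ : ℕ∞) a)
    (has : Function.support a ⊆ {g | hnorm g ≤ 1}) (hb : Continuous b)
    (hbs : Function.support b ⊆ {g | hnorm g ≤ 1}) (hb0 : ∫ g, b g = 0) :
    ∃ C : ℝ, 0 < C ∧ ∀ (K : Heis n → ℝ) (C₀ : ℝ), 0 < C₀ → IsCZKernel n N K C₀ →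
      ∀ r R η q D : ℝ, 0 < r → r ≤ R → 0 < η → r * η ≤ 1 → 0 < q → 0 ≤ D →
      ∀ c d : ℝ → ℝ, Continuous c → Integrable c → Integrable d →
      (∀ s, |rconv c d s| ≤ D * wgt q s) → ∀ g : Heis n,
      |∫ v in {v : Heis n | η < hnorm v}, K v * ∫ w, vconv (hdilNorm r a) c w *
          vconv (hdilNorm R b) d (hmul (hinv v) (hmul (hinv w) g))| ≤
        C * C₀ * (r / R) * D * (r ^ (2 * n) / (1 + r * znorm g) ^ (2 * (n : ℝ) + 1 / 2) *
          wgt (min q (r ^ 2)) g.2.2) := by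
  obtain ⟨C, hC, h⟩ := IsCZKernel.abs_conv₂_le N ha has hb hbs hb0
  set I := ∫ s, wgt 1 s with hI
  have hI0 : 0 ≤ I := integral_nonneg fun s => wgt_nonneg one_pos s
  refine ⟨C * (4 ^ (5 / 4 : ℝ) * (2 * I) + 1), by positivity, ?_⟩
  intro K C₀ hC₀ hK r R η q D hr hrR hη hη' hq hD c d hcc hc hd hH g
  have hR := hr.trans_le hrR
  rw [setIntegral_eq_kap, integral_vconv_mul_vconv (hK.measurable_kap hη) (hK.abs_kap_le hC₀ hη)
    (continuous_hdilNorm ha.continuous).measurable (integrable_hdilNorm hr ha.continuous has)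
    (continuous_hdilNorm hb).measurable (integrable_hdilNorm hR hb hbs) hcc.measurable hc hd]
  set Z := r ^ (2 * n) / (1 + r * znorm g) ^ (2 * (n : ℝ) + 1 / 2) with hZ
  have hz := znorm_nonneg g
  have hZ0 : 0 ≤ Z := by positivity
  have hr2 : 0 < r ^ 2 := by positivity
  have hbound : ∀ s, |rconv c d s * conv₂ (kap η K) (hdilNorm r a) (hdilNorm R b) (tsh s g)| ≤
      D * (C * C₀ * (r / R)) * Z * (wgt q s * wgt (r ^ 2) (g.2.2 - s)) := by
    intro s
    have h1 := (h K C₀ hC₀ hK r R η hr hrR hη hη' (tsh s g)).trans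
      (mul_le_mul_of_nonneg_left (pow_div_le_mul_wgt hr (tsh s g)) (by positivity))
    have hzt : znorm (tsh s g) = znorm g := rfl
    rw [hzt, ← hZ] at h1
    rw [abs_mul]
    refine (mul_le_mul (hH s) h1 (abs_nonneg _) (mul_nonneg hD (wgt_nonneg hq s))).trans
      (le_of_eq ?_)
    simp only [tsh]
    ring
  refine (norm_integral_le_of_norm_le (G := ℝ) ((integrable_wgt_mul_wgt hq hr2 g.2.2).const_mul _)
    (ae_of_all _ hbound)).trans ?_
  rw [integral_const_mul]
  have hw := wgt_nonneg (lt_min hq hr2) g.2.2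
  calc _ ≤ D * (C * C₀ * (r / R)) * Z *
        (4 ^ (5 / 4 : ℝ) * (2 * I) * wgt (min q (r ^ 2)) g.2.2) := by
        gcongr
        exact integral_wgt_mul_wgt_le hq hr2 _
    _ ≤ D * (C * C₀ * (r / R)) * Z *
        ((4 ^ (5 / 4 : ℝ) * (2 * I) + 1) * wgt (min q (r ^ 2)) g.2.2) := by
        gcongr
        linarith
    _ = _ := by ring

/-! ### Almost orthogonality in the central variable -/

/-- Quantitative decay, modulus of continuity and cancellation of a function on `ℝ`. -/
structure IsVBump (B : ℝ) (φ : ℝ → ℝ) : Prop where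
  continuous : Continuous φ
  abs_le : ∀ u, |φ u| ≤ B / (1 + |u|) ^ 5
  abs_sub_le : ∀ x y, |φ (x - y) - φ x| ≤ B * (|y| * (1 + |y|) ^ 2) / (1 + |x|) ^ 2
  integral_eq_zero : ∫ u, φ u = 0

lemma integrable_inv_one_add_sq : Integrable fun u : ℝ => ((1 + |u|) ^ 2)⁻¹ := by
  have := integrable_one_add_norm (E := ℝ) (μ := volume) (r := 2) (by norm_num)
  refine this.congr (ae_of_all _ fun s => ?_)
  simp only [Real.norm_eq_abs]
  rw [Real.rpow_neg (by positivity), Real.rpow_ofNat]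

lemma IsVBump.neg {B : ℝ} {φ : ℝ → ℝ} (h : IsVBump B φ) : IsVBump B fun u => φ (-u) where
  continuous := h.continuous.comp continuous_neg
  abs_le u := by simpa using h.abs_le (-u)
  abs_sub_le x y := by
    have := h.abs_sub_le (-x) (-y)
    rw [abs_neg, abs_neg] at this
    rwa [show -(x - y) = -x - -y by ring]
  integral_eq_zero := by rw [integral_neg_eq_self φ, h.integral_eq_zero]

lemma IsVBump.integrable {B : ℝ} {φ : ℝ → ℝ} (h : IsVBump B φ) : Integrable φ := by
  refine (integrable_inv_one_add_sq.const_mul B).mono' h.continuous.aestronglyMeasurable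
    (ae_of_all _ fun u => ?_)
  have hB : 0 ≤ B := by simpa using (abs_nonneg _).trans (h.abs_le 0)
  refine (h.abs_le u).trans ?_
  rw [← div_eq_mul_inv]
  gcongr
  · exact le_add_of_nonneg_right (abs_nonneg u)
  · norm_num

/-- The dilate `p φ(p u)`. -/
noncomputable def rdil (p : ℝ) (φ : ℝ → ℝ) (u : ℝ) : ℝ := p * φ (p * u)

lemma IsVBump.continuous_rdil {B : ℝ} {φ : ℝ → ℝ} (h : IsVBump B φ) (p : ℝ) :
    Continuous (rdil p φ) :=
  continuous_const.mul (h.continuous.comp (by fun_prop))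

lemma IsVBump.integrable_rdil {B : ℝ} {φ : ℝ → ℝ} (h : IsVBump B φ) {p : ℝ} (hp : 0 < p) :
    Integrable (rdil p φ) :=
  (h.integrable.comp_mul_left' hp.ne').const_mul p

lemma integral_rdil {p : ℝ} (hp : 0 < p) (φ : ℝ → ℝ) : ∫ u, rdil p φ u = ∫ u, φ u := by
  unfold rdil
  rw [integral_const_mul, Measure.integral_comp_mul_left, abs_of_pos (inv_pos.2 hp),
    smul_eq_mul, mul_inv_cancel_left₀ hp.ne']

lemma rconv_comm (c d : ℝ → ℝ) (s : ℝ) : rconv c d s = rconv d c s := by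
  unfold rconv
  rw [← integral_sub_left_eq_self _ _ s]
  simp only [sub_sub_cancel, mul_comm]

lemma IsVBump.abs_rconv_le {B : ℝ} {φ φ' : ℝ → ℝ} (h : IsVBump B φ) (h' : IsVBump B φ')
    {p p' : ℝ} (hp : 0 < p) (hp' : p ≤ p') (s : ℝ) :
    |rconv (rdil p φ) (rdil p' φ') s| ≤
      (B ^ 2 * ∫ u : ℝ, ((1 + |u|) ^ 2)⁻¹) * (p / p') * wgt p s := by
  have hp0' := hp.trans_le hp'
  have hB : 0 ≤ B := by simpa using (abs_nonneg _).trans (h.abs_le 0)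
  have i1 : Integrable fun u => rdil p' φ' u * rdil p φ (s - u) := by
    simp only [mul_comm (rdil p' φ' _)]
    refine (h'.integrable_rdil hp0').bdd_mul (c := p * B)
      ((h.continuous_rdil p).comp (by fun_prop)).aestronglyMeasurable (ae_of_all _ fun u => ?_)
    rw [Real.norm_eq_abs, rdil, abs_mul, abs_of_pos hp]
    gcongr
    refine (h.abs_le _).trans (div_le_self hB (one_le_pow₀ ?_))
    exact le_add_of_nonneg_right (abs_nonneg _)
  have e : rconv (rdil p φ) (rdil p' φ') s =
      ∫ u, rdil p' φ' u * (rdil p φ (s - u) - rdil p φ s) := by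
    simp only [mul_sub]
    rw [integral_sub i1 ((h'.integrable_rdil hp0').mul_const _), integral_mul_const,
      integral_rdil hp0', h'.integral_eq_zero, zero_mul, sub_zero, rconv]
  have hbound : ∀ u, |rdil p' φ' u * (rdil p φ (s - u) - rdil p φ s)| ≤
      B ^ 2 * (p / p') * wgt p s * rdil p' (fun u => ((1 + |u|) ^ 2)⁻¹) u := by
    intro u
    have m := h.abs_sub_le (p * s) (p * u)
    have dd := h'.abs_le (p' * u)
    simp only [abs_mul, abs_of_pos hp, abs_of_pos hp0'] at m dd
    have hpu : p * |u| ≤ p' * |u| := by gcongr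
    have hone : 1 ≤ 1 + p * |s| := le_add_of_nonneg_right (by positivity)
    have hw : p / (1 + p * |s|) ^ 2 ≤ wgt p s := by
      unfold wgt
      rw [← Real.rpow_natCast]
      gcongr
      · norm_num
    simp only [rdil]
    rw [← mul_sub, mul_sub p s u, abs_mul, abs_mul, abs_mul, abs_of_pos hp, abs_of_pos hp0', abs_mul,
      abs_of_pos hp0']
    calc _ ≤ p' * (B / (1 + p' * |u|) ^ 5) *
          (p * (B * (p * |u| * (1 + p' * |u|) ^ 2) / (1 + p * |s|) ^ 2)) := by
          gcongr
          refine m.trans ?_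
          gcongr
      _ = B ^ 2 * (p / p') * (p / (1 + p * |s|) ^ 2) *
          (p' * (p' * |u| / (1 + p' * |u|) ^ 3)) := by
          field_simp
      _ ≤ B ^ 2 * (p / p') * wgt p s * (p' * (p' * |u| / (1 + p' * |u|) ^ 3)) := by gcongr
      _ ≤ _ := by
          have := wgt_nonneg hp s
          gcongr
          rw [← one_div, div_le_div_iff₀ (by positivity) (by positivity)]
          have hx : 0 ≤ p' * |u| := by positivity
          nlinarith [sq_nonneg (1 + p' * |u|)]
  have i2 : Integrable (rdil p' fun u => ((1 + |u|) ^ 2)⁻¹) :=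
    (integrable_inv_one_add_sq.comp_mul_left' hp0'.ne').const_mul p'
  rw [e]
  refine (norm_integral_le_of_norm_le (G := ℝ) (i2.const_mul _) (ae_of_all _ hbound)).trans
    (le_of_eq ?_)
  rw [integral_const_mul, integral_rdil hp0']
  ring

lemma exists_isVBump (ψ : SchwartzMap ℝ ℝ) (hψ : ∫ u, ψ u = 0) : ∃ B, IsVBump B ψ := by
  obtain ⟨B₀, h₀⟩ : ∃ B₀, ∀ u, |ψ u| ≤ B₀ / (1 + |u|) ^ 5 := by
    have h := SchwartzMap.one_add_le_sup_seminorm_apply (𝕜 := ℝ) (m := (5, 0)) (k := 5) (n := 0)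
      le_rfl le_rfl ψ
    simp only [norm_iteratedFDeriv_zero, Real.norm_eq_abs] at h
    exact ⟨_, fun u => (le_div_iff₀ (by positivity)).2 ((mul_comm _ _).trans_le (h u))⟩
  obtain ⟨B₁, h₁⟩ : ∃ B₁, ∀ u, |deriv ψ u| ≤ B₁ / (1 + |u|) ^ 2 := by
    have h := SchwartzMap.one_add_le_sup_seminorm_apply (𝕜 := ℝ) (m := (2, 1)) (k := 2) (n := 1)
      le_rfl le_rfl ψ
    simp only [norm_iteratedFDeriv_eq_norm_iteratedDeriv, iteratedDeriv_one,
      Real.norm_eq_abs] at h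
    exact ⟨_, fun u => (le_div_iff₀ (by positivity)).2 ((mul_comm _ _).trans_le (h u))⟩
  have hB₁ : 0 ≤ B₁ := by simpa using (abs_nonneg _).trans (h₁ 0)
  refine ⟨max B₀ B₁, ψ.continuous, fun u => (h₀ u).trans (by gcongr; exact le_max_left _ _),
    fun x y => ?_, hψ⟩
  have key := norm_image_sub_le_of_norm_deriv_le_segment_01' (f := fun s : ℝ => ψ (x - s * y))
    (f' := fun s => deriv ψ (x - s * y) * (-y))
    (C := B₁ * (|y| * (1 + |y|) ^ 2) / (1 + |x|) ^ 2) ?_ ?_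
  · simp only [one_mul, zero_mul, sub_zero] at key
    refine key.trans ?_
    gcongr
    exact le_max_right _ _
  · intro s _
    have hline : HasDerivAt (fun s : ℝ => x - s * y) (-y) s := by
      simpa using ((hasDerivAt_id s).mul_const y).const_sub x
    exact (ψ.differentiable.differentiableAt.hasDerivAt.comp s hline).hasDerivWithinAt
  · intro s hs
    have hx : 1 + |x| ≤ (1 + |x - s * y|) * (1 + |y|) := by
      have h1 : |x| ≤ |x - s * y| + |s * y| := by simpa using abs_add_le (x - s * y) (s * y)
      have h2 : |s * y| ≤ |y| := by
        rw [abs_mul, abs_of_nonneg hs.1]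
        exact mul_le_of_le_one_left (abs_nonneg y) hs.2.le
      nlinarith [mul_nonneg (abs_nonneg (x - s * y)) (abs_nonneg y)]
    rw [norm_mul, Real.norm_eq_abs, Real.norm_eq_abs, abs_neg]
    calc _ ≤ B₁ / (1 + |x - s * y|) ^ 2 * |y| := by
          gcongr
          exact h₁ _
      _ = B₁ * (|y| * (1 + |y|) ^ 2) / ((1 + |x - s * y|) * (1 + |y|)) ^ 2 := by
          field_simp
      _ ≤ _ := by gcongr

/-! ### The dyadic estimate -/

lemma psijk_eq_vconv (ψ1 : Heis n → ℝ) (ψ2 : ℝ → ℝ) (j k : ℤ) :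
    psijk ψ1 ψ2 j k = vconv (hdilNorm ((2 : ℝ) ^ j) ψ1) (rdil ((2 : ℝ) ^ k) ψ2) := rfl

lemma psijk_neg (ψ1 : Heis n → ℝ) (ψ2 : ℝ → ℝ) (j k : ℤ) :
    vconv (fun x => hdilNorm ((2 : ℝ) ^ j) ψ1 (-x)) (fun u => rdil ((2 : ℝ) ^ k) ψ2 (-u)) =
      psijk (fun x => ψ1 (-x)) (fun u => ψ2 (-u)) j k := by
  rw [psijk_eq_vconv]
  congr 1
  · funext x
    rw [hdilNorm, ← hinv_eq_neg, hdil_hinv]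
    rfl
  · funext u
    simp only [rdil, mul_neg]

lemma two_zpow_div {m m' : ℤ} (h : m ≤ m') :
    (2 : ℝ) ^ m / 2 ^ m' = 2 ^ (-((m - m').natAbs : ℤ)) := by
  rw [← zpow_sub₀ two_ne_zero]
  congr 1
  omega

lemma IsVBump.abs_rconv_zpow_le {B : ℝ} {φ : ℝ → ℝ} (h : IsVBump B φ) (k k' : ℤ) (s : ℝ) :
    |rconv (rdil ((2 : ℝ) ^ k) φ) (rdil ((2 : ℝ) ^ k') φ) s| ≤
      (B ^ 2 * ∫ u : ℝ, ((1 + |u|) ^ 2)⁻¹) * (2 : ℝ) ^ (-((k - k').natAbs : ℤ)) *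
        wgt ((2 : ℝ) ^ min k k') s := by
  wlog hk : k ≤ k' generalizing k k'
  · have := this k' k (le_of_not_ge hk)
    rwa [rconv_comm, min_comm, ← Int.natAbs_neg, neg_sub] at this
  have := h.abs_rconv_le h (p := (2 : ℝ) ^ k) (p' := (2 : ℝ) ^ k') (by positivity)
    (zpow_le_zpow_right₀ one_le_two hk) s
  rw [two_zpow_div hk] at this
  rwa [min_eq_left hk]

lemma _root_.IsCZKernel.abs_integral_psijk_le (N : ℕ) {ψ1 : Heis n → ℝ}
    (hψ : ContDiff ℝ (⊤ : ℕ∞) ψ1) (hs : Function.support ψ1 ⊆ {g | hnorm g ≤ 1})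
    (h0 : ∫ g, ψ1 g = 0) (B : ℝ) :
    ∃ C : ℝ, 0 < C ∧ ∀ (K : Heis n → ℝ) (C₀ : ℝ), 0 < C₀ → IsCZKernel n N K C₀ →
      ∀ ψ2 : ℝ → ℝ, IsVBump B ψ2 → ∀ j j' : ℤ, j ≤ j' → ∀ (k k' : ℤ) (η : ℝ), 0 < η →
      (2 : ℝ) ^ j * η ≤ 1 → ∀ g : Heis n,
      |∫ v in {v : Heis n | η < hnorm v}, K v * ∫ w, psijk ψ1 ψ2 j k w *
          psijk ψ1 ψ2 j' k' (hmul (hinv v) (hmul (hinv w) g))| ≤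
        C * C₀ * (2 : ℝ) ^ (-((j - j').natAbs : ℤ)) * (2 : ℝ) ^ (-((k - k').natAbs : ℤ)) *
          (((2 : ℝ) ^ j) ^ (2 * n) / (1 + (2 : ℝ) ^ j * znorm g) ^ (2 * (n : ℝ) + 1 / 2)) *
          wgt (min ((2 : ℝ) ^ min k k') (((2 : ℝ) ^ j) ^ 2)) g.2.2 := by
  obtain ⟨C, hC, h⟩ := IsCZKernel.abs_integral_le N hψ hs hψ.continuous hs h0
  set D := B ^ 2 * ∫ u : ℝ, ((1 + |u|) ^ 2)⁻¹ with hD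
  have hD0 : 0 ≤ D := mul_nonneg (sq_nonneg B) (integral_nonneg fun u => by positivity)
  refine ⟨C * (D + 1), by positivity, ?_⟩
  intro K C₀ hC₀ hK ψ2 h2 j j' hj k k' η hη hη' g
  have hr : (0 : ℝ) < 2 ^ j := by positivity
  have hz := znorm_nonneg g
  have hq : (0 : ℝ) < 2 ^ min k k' := by positivity
  have hw := wgt_nonneg (lt_min hq (pow_pos hr 2)) g.2.2
  refine (h K C₀ hC₀ hK (2 ^ j) (2 ^ j') η (2 ^ min k k') (D * 2 ^ (-((k - k').natAbs : ℤ))) hr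
    (zpow_le_zpow_right₀ one_le_two hj) hη hη' hq (by positivity) _ _ (h2.continuous_rdil _)
    (h2.integrable_rdil (by positivity)) (h2.integrable_rdil (by positivity))
    (h2.abs_rconv_zpow_le k k') g).trans ?_
  rw [two_zpow_div hj]
  calc _ = C * D * C₀ * (2 : ℝ) ^ (-((j - j').natAbs : ℤ)) * (2 : ℝ) ^ (-((k - k').natAbs : ℤ)) *
          (((2 : ℝ) ^ j) ^ (2 * n) / (1 + (2 : ℝ) ^ j * znorm g) ^ (2 * (n : ℝ) + 1 / 2)) *
          wgt (min ((2 : ℝ) ^ min k k') (((2 : ℝ) ^ j) ^ 2)) g.2.2 := by ring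
    _ ≤ _ := by
      gcongr
      linarith

lemma inv_rpow_div {r x α β : ℝ} (hr : 0 < r) (hx : 0 ≤ x) :
    r⁻¹ ^ α / (r⁻¹ + x) ^ β = r ^ (β - α) / (1 + r * x) ^ β := by
  have : r⁻¹ + x = r⁻¹ * (1 + r * x) := by field_simp
  rw [this, Real.mul_rpow (by positivity) (by positivity), Real.inv_rpow hr.le, Real.inv_rpow hr.le,
    Real.rpow_sub hr]
  field_simp

lemma wgt_sq_le {r : ℝ} (hr : 0 < r) (t : ℝ) :
    wgt (r ^ 2) t ≤ 2 ^ (5 / 4 : ℝ) * (r ^ (2 : ℝ) / (1 + r * √|t|) ^ (5 / 2 : ℝ)) := by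
  have e : (1 + r * √|t|) ^ (5 / 2 : ℝ) = ((1 + r * √|t|) ^ 2) ^ (5 / 4 : ℝ) := by
    rw [← Real.rpow_natCast _ 2, ← Real.rpow_mul (by positivity)]
    norm_num
  have h : (1 + r * √|t|) ^ 2 ≤ 2 * (1 + r ^ 2 * |t|) := by
    have := Real.sq_sqrt (abs_nonneg t)
    nlinarith [sq_nonneg (1 - r * √|t|)]
  have h' : (1 + r * √|t|) ^ (5 / 2 : ℝ) ≤ 2 ^ (5 / 4 : ℝ) * (1 + r ^ 2 * |t|) ^ (5 / 4 : ℝ) := by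
    rw [e, ← Real.mul_rpow (by positivity) (by positivity)]
    gcongr
  rw [wgt, Real.rpow_two, ← mul_div_assoc, div_le_div_iff₀ (by positivity) (by positivity)]
  calc _ ≤ r ^ 2 * (2 ^ (5 / 4 : ℝ) * (1 + r ^ 2 * |t|) ^ (5 / 4 : ℝ)) := by gcongr
    _ = _ := by ring

lemma two_zpow_neg_natCast_le_rpow (m : ℕ) {ε : ℝ} (hε : ε ≤ 1) :
    (2 : ℝ) ^ (-(m : ℤ)) ≤ (2 : ℝ) ^ (-(m : ℝ) * ε) := by
  rw [← Real.rpow_intCast]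
  refine Real.rpow_le_rpow_of_exponent_le one_le_two ?_
  push_cast
  nlinarith [(Nat.cast_nonneg m : (0 : ℝ) ≤ m)]

end HeisFlag

theorem stmt11 (n : ℕ) (hn : 1 ≤ n) :
    ∃ N : ℕ, ∃ c₀ : ℝ, 0 < c₀ ∧ c₀ < 1 ∧
      ∀ (K : Heis n → ℝ) (C₀ : ℝ), 0 < C₀ → IsCZKernel n N K C₀ →
        ∀ ψ1 : Heis n → ℝ, ContDiff ℝ (⊤ : ℕ∞) ψ1 →
          Function.support ψ1 ⊆ {g : Heis n | hnorm g ≤ c₀} →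
          (∫ g, ψ1 g) = 0 →
          ∀ ψ2 : SchwartzMap ℝ ℝ, (∫ u, ψ2 u) = 0 → (∫ u : ℝ, u * ψ2 u) = 0 →
            ∀ W : ℤ → ℤ → ℤ → ℤ → Heis n → ℝ,
              -- `W j k j' k'` is the principal-value triple convolution
              -- `ψ_{j,k} ∗ K ∗ ψ_{j',k'}`, assumed to exist
              (∀ (j k j' k' : ℤ) (g : Heis n),
                Tendsto (fun η : ℝ => ∫ v in {v : Heis n | η < hnorm v},
                    K v * ∫ w : Heis n, psijk ψ1 (⇑ψ2) j k w *
                      psijk ψ1 (⇑ψ2) j' k' (hmul (hinv v) (hmul (hinv w) g)))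
                  (nhdsWithin 0 (Set.Ioi 0)) (nhds (W j k j' k' g))) →
              ∀ ε : ℝ, 0 < ε → ε < 1 → ∃ C : ℝ, 0 < C ∧
                ∀ (j k j' k' : ℤ) (g : Heis n),
                  (min k k' ≤ 2 * min j j' →
                    |W j k j' k' g| ≤
                      C * (2 : ℝ) ^ (-(((j - j').natAbs : ℝ)) * ε) *
                        (2 : ℝ) ^ (-((k - k').natAbs : ℤ)) *
                        (((2 : ℝ) ^ (-(min j j'))) ^ ((1 : ℝ) / 2) /
                          ((2 : ℝ) ^ (-(min j j')) + znorm g) ^ (2 * (n : ℝ) + 1 / 2)) *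
                        (((2 : ℝ) ^ (-(min k k'))) ^ ((1 : ℝ) / 4) /
                          ((2 : ℝ) ^ (-(min k k')) + |g.2.2|) ^ ((5 : ℝ) / 4))) ∧
                  (2 * min j j' ≤ min k k' →
                    |W j k j' k' g| ≤
                      C * (2 : ℝ) ^ (-(((j - j').natAbs : ℝ)) * ε) *
                        (2 : ℝ) ^ (-((k - k').natAbs : ℤ)) *
                        (((2 : ℝ) ^ (-(min j j'))) ^ ((1 : ℝ) / 2) /
                          ((2 : ℝ) ^ (-(min j j')) + znorm g) ^ (2 * (n : ℝ) + 1 / 2)) *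
                        (((2 : ℝ) ^ (-(min j j'))) ^ ((1 : ℝ) / 2) /
                          ((2 : ℝ) ^ (-(min j j')) + Real.sqrt |g.2.2|) ^ ((5 : ℝ) / 2))) := by
  refine ⟨1, 1 / 2, by norm_num, by norm_num, ?_⟩
  intro K C₀ hC₀ hK ψ1 hψ1 hs h0 ψ2 h20 _ W hW ε _ hε1
  obtain ⟨B, hB⟩ := HeisFlag.exists_isVBump ψ2 h20
  have hs1 : Function.support ψ1 ⊆ {g : Heis n | hnorm g ≤ 1} :=
    hs.trans fun g hg => le_trans (show hnorm g ≤ 1 / 2 from hg) (by norm_num)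
  obtain ⟨C₁, hC₁, h₁⟩ := IsCZKernel.abs_integral_psijk_le 1 hψ1 hs1 h0 B
  obtain ⟨C₂, hC₂, h₂⟩ := IsCZKernel.abs_integral_psijk_le 1 (ψ1 := fun x => ψ1 (-x))
    (hψ1.comp contDiff_neg)
    (fun g hg => by
      have : hnorm (-g) ≤ 1 := hs1 hg
      rwa [HeisFlag.hnorm_neg] at this)
    ((HeisFlag.integral_hinv ψ1).trans h0) B
  have main : ∀ (j k j' k' : ℤ) (g : Heis n), |W j k j' k' g| ≤
      (C₁ + C₂) * C₀ * (2 : ℝ) ^ (-((j - j').natAbs : ℤ)) * (2 : ℝ) ^ (-((k - k').natAbs : ℤ)) *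
        (((2 : ℝ) ^ min j j') ^ (2 * n) /
          (1 + (2 : ℝ) ^ min j j' * znorm g) ^ (2 * (n : ℝ) + 1 / 2)) *
        HeisFlag.wgt (min ((2 : ℝ) ^ min k k') (((2 : ℝ) ^ min j j') ^ 2)) g.2.2 := by
    intro j k j' k' g
    have hr : (0 : ℝ) < 2 ^ min j j' := by positivity
    have hz := HeisFlag.znorm_nonneg g
    have hw := HeisFlag.wgt_nonneg
      (lt_min (show (0 : ℝ) < 2 ^ min k k' by positivity) (pow_pos hr 2)) g.2.2
    refine le_of_tendsto (hW j k j' k' g).abs ?_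
    filter_upwards [Ioc_mem_nhdsGT (inv_pos.2 hr)] with η hη
    have hη' : (2 : ℝ) ^ min j j' * η ≤ 1 := by
      have := mul_le_mul_of_nonneg_left hη.2 hr.le
      rwa [mul_inv_cancel₀ hr.ne'] at this
    rcases le_total j j' with hj | hj
    · rw [min_eq_left hj] at *
      refine (h₁ K C₀ hC₀ hK ψ2 hB j j' hj k k' η hη.1 hη' g).trans ?_
      gcongr
      exact le_add_of_nonneg_right hC₂.le
    · rw [min_eq_right hj] at *
      have := h₂ _ C₀ hC₀ hK.comp_neg _ hB.neg j' j hj k' k η hη.1 hη' (-g)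
      simp only [← HeisFlag.psijk_neg] at this
      rw [← HeisFlag.integral_vconv_mul_vconv_neg, HeisFlag.znorm_neg, ← Int.natAbs_neg, neg_sub,
        ← Int.natAbs_neg (k' - k), neg_sub, min_comm k' k] at this
      simp only [Prod.snd_neg, HeisFlag.wgt, abs_neg] at this
      refine this.trans ?_
      rw [HeisFlag.wgt] at *
      gcongr
      exact le_add_of_nonneg_left hC₁.le
  refine ⟨(C₁ + C₂) * C₀ * 2 ^ (5 / 4 : ℝ), by positivity, fun j k j' k' g => ?_⟩
  have hr : (0 : ℝ) < 2 ^ min j j' := by positivity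
  have hq : (0 : ℝ) < 2 ^ min k k' := by positivity
  have hz := HeisFlag.znorm_nonneg g
  have hm := main j k j' k' g
  have hA : 0 < (C₁ + C₂) * C₀ := by positivity
  have e1 : ((2 : ℝ) ^ min j j') ^ (2 * n) = ((2 : ℝ) ^ min j j') ^ (2 * (n : ℝ) + 1 / 2 - 1 / 2) := by
    rw [add_sub_cancel_right, ← Real.rpow_natCast]
    push_cast
    rfl
  have hone : (1 : ℝ) ≤ 2 ^ (5 / 4 : ℝ) := Real.one_le_rpow one_le_two (by norm_num)
  have hε := HeisFlag.two_zpow_neg_natCast_le_rpow (j - j').natAbs hε1.le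
  simp only [zpow_neg (2 : ℝ) (min _ _), HeisFlag.inv_rpow_div hr hz,
    HeisFlag.inv_rpow_div hq (abs_nonneg g.2.2),
    HeisFlag.inv_rpow_div hr (Real.sqrt_nonneg |g.2.2|), ← e1]
  have hsq : ((2 : ℝ) ^ min j j') ^ 2 = 2 ^ (2 * min j j') := by
    rw [← zpow_natCast, ← zpow_mul, mul_comm]
    rfl
  constructor
  · intro hle
    have hmin : min ((2 : ℝ) ^ min k k') (((2 : ℝ) ^ min j j') ^ 2) = 2 ^ min k k' := by
      rw [hsq]
      exact min_eq_left (zpow_le_zpow_right₀ one_le_two hle)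
    rw [hmin] at hm
    have ew : HeisFlag.wgt ((2 : ℝ) ^ min k k') g.2.2 = ((2 : ℝ) ^ min k k') ^ (5 / 4 - 1 / 4 : ℝ) /
        (1 + (2 : ℝ) ^ min k k' * |g.2.2|) ^ (5 / 4 : ℝ) := by
      norm_num [HeisFlag.wgt]
    rw [ew] at hm
    refine hm.trans ?_
    generalize (C₁ + C₂) * C₀ = A at hA
    gcongr
    exact le_mul_of_one_le_right hA.le hone
  · intro hle
    have hmin : min ((2 : ℝ) ^ min k k') (((2 : ℝ) ^ min j j') ^ 2) = ((2 : ℝ) ^ min j j') ^ 2 := by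
      rw [hsq]
      exact min_eq_right (zpow_le_zpow_right₀ one_le_two hle)
    rw [hmin] at hm
    have hw := HeisFlag.wgt_sq_le hr g.2.2
    have hw0 := HeisFlag.wgt_nonneg (pow_pos hr 2) g.2.2
    have e2 : (5 / 2 - 1 / 2 : ℝ) = 2 := by norm_num
    rw [e2]
    calc _ ≤ (C₁ + C₂) * C₀ * (2 : ℝ) ^ (-((j - j').natAbs : ℝ) * ε) *
          (2 : ℝ) ^ (-((k - k').natAbs : ℤ)) *
          (((2 : ℝ) ^ min j j') ^ (2 * n) /
            (1 + (2 : ℝ) ^ min j j' * znorm g) ^ (2 * (n : ℝ) + 1 / 2)) *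
          (2 ^ (5 / 4 : ℝ) * (((2 : ℝ) ^ min j j') ^ (2 : ℝ) /
            (1 + (2 : ℝ) ^ min j j' * √|g.2.2|) ^ (5 / 2 : ℝ))) := by
          refine hm.trans ?_
          gcongr
      _ = _ := by ring
end
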